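/- arXiv:1807.10963 — 2 statements merged into one kernel-verified Lean document; each statement's English description precedes it below -/
import Mathlib

section
/- There exists a compact set X ⊂ ℂ² such that its polynomial hull X̂ strictly contains X, yet X̂ contains no subspace homeomorphic to the closed unit disc in ℝ². -/
/-- The closed unit disc in ℝ². -/
def ClosedUnitDisc : Set (EuclideanSpace ℝ (Fin 2)) := Metric.closedBall 0 1

/-- The polynomial hull of a compact set `X ⊆ ℂ^N`. -/
def polyHull {N : ℕ} (X : Set (Fin N → ℂ)) : Set (Fin N → ℂ) :=
  {z | ∀ p : MvPolynomial (Fin N) ℂ,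
    ‖MvPolynomial.eval z p‖ ≤ sSup ((fun x => ‖MvPolynomial.eval x p‖) '' X)}

open Polynomial in
/-- For a plane curve `P(z, w) = 0` with `P` monic in `w`, the values of `Q` on the fibre over `z`
are the roots of a monic polynomial of fixed degree whose coefficients are polynomials in `z`. -/
lemma exists_monic_fibre_values (P Q : ℂ[X][X]) (hP : P.Monic) :
    ∃ χ : ℂ[X][X], χ.Monic ∧ χ.natDegree = P.natDegree ∧
      (∀ z w, P.evalEval z w = 0 → χ.evalEval z (Q.evalEval z w) = 0) ∧
      ∀ z t, χ.evalEval z t = 0 → ∃ w, P.evalEval z w = 0 ∧ Q.evalEval z w = t := by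
  classical
  set b := (AdjoinRoot.powerBasis' hP).basis with hb
  set M := Algebra.leftMulMatrix b with hM
  have heval (z w : ℂ) (F : ℂ[X][X]) : F.evalEval z w = (F.map (evalRingHom z)).eval w := by
    rw [map_evalRingHom_eval]
  refine ⟨(M (AdjoinRoot.mk P Q)).charpoly, Matrix.charpoly_monic _, ?_, ?_, ?_⟩
  · rw [Matrix.charpoly_natDegree_eq_dim, Fintype.card_fin, AdjoinRoot.powerBasis'_dim]
  · intro z w h
    have h0 : aeval (AdjoinRoot.mk P Q) (M (AdjoinRoot.mk P Q)).charpoly = 0 := by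
      apply Algebra.leftMulMatrix_injective b
      rw [← Polynomial.aeval_algHom_apply, map_zero]
      exact Matrix.aeval_self_charpoly _
    have h1 : AdjoinRoot.mk P ((M (AdjoinRoot.mk P Q)).charpoly.comp Q) = 0 := by
      rw [← h0, ← AdjoinRoot.aeval_eq, ← AdjoinRoot.aeval_eq, aeval_comp]
    obtain ⟨R, hR⟩ := AdjoinRoot.mk_eq_zero.1 h1
    have h2 := congrArg (evalEval z w) hR
    rw [evalEval_mul, h, zero_mul] at h2
    rw [← h2, heval, heval, heval, Polynomial.map_comp, eval_comp]
  · intro z t h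
    set e := (evalRingHom z : ℂ[X] →+* ℂ)
    set N := (M (AdjoinRoot.root P)).map e with hN
    have key (F : ℂ[X][X]) : (M (AdjoinRoot.mk P F)).map e = aeval N (F.map e) := by
      rw [← AdjoinRoot.aeval_eq, ← Polynomial.aeval_algHom_apply, aeval_def, aeval_def]
      rw [eval₂_map]
      change e.mapMatrix _ = _
      rw [Polynomial.hom_eval₂]
      congr 1
      ext x i j
      · simp [Matrix.algebraMap_matrix_apply]
        split_ifs <;> simp
      · simp [Matrix.algebraMap_matrix_apply]
        split_ifs <;> simp
    have ht : t ∈ spectrum ℂ (aeval N (Q.map e)) := by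
      rw [← key, Matrix.mem_spectrum_iff_isRoot_charpoly, Matrix.charpoly_map, IsRoot, ← heval]
      exact h
    have hne : (spectrum ℂ N).Nonempty := by
      have : Nontrivial (Matrix (Fin (AdjoinRoot.powerBasis' hP).dim)
          (Fin (AdjoinRoot.powerBasis' hP).dim) ℂ) := by
        by_contra hn
        rw [not_nontrivial_iff_subsingleton] at hn
        rw [spectrum.of_subsingleton] at ht
        exact ht
      exact spectrum.nonempty_of_isAlgClosed_of_finiteDimensional ℂ N
    rw [spectrum.map_polynomial_aeval_of_nonempty _ _ hne] at ht
    obtain ⟨w, hw, rfl⟩ := ht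
    refine ⟨w, ?_, by rw [heval]⟩
    have h3 := spectrum.subset_polynomial_aeval N (P.map e) ⟨w, hw, rfl⟩
    rw [← key, AdjoinRoot.mk_self, map_zero] at h3
    have h4 : (0 : Matrix (Fin (AdjoinRoot.powerBasis' hP).dim)
        (Fin (AdjoinRoot.powerBasis' hP).dim) ℂ[X]).map e = 0 := by
      ext; simp
    rw [h4, spectrum.mem_iff] at h3
    rw [heval]
    by_contra hx
    apply h3
    rw [sub_zero]
    exact (IsUnit.mk0 _ hx).map _

open Polynomial in
lemma norm_coeff_eval_le_of_sphere {P : ℂ[X]} {C : ℝ}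
    (h : ∀ z : ℂ, ‖z‖ = 1 → ‖P.eval z‖ ≤ C) {z : ℂ}
    (hz : ‖z‖ ≤ 1) : ‖P.eval z‖ ≤ C := by
  refine Complex.norm_le_of_forall_mem_frontier_norm_le (U := Metric.ball 0 1)
    Metric.isBounded_ball P.differentiable.diffContOnCl ?_ ?_
  · intro w hw
    rw [frontier_ball _ one_ne_zero] at hw
    exact h w (by simpa using hw)
  · rw [closure_ball _ one_ne_zero]
    simpa using hz

open Polynomial in
/-- Maximum principle on a plane curve `P(z, w) = 0` with `P` monic in `w`, up to a constant. -/
lemma norm_le_mul_of_sphere {P Q : ℂ[X][X]} (hP : P.Monic) {M : ℝ} (hM : 0 < M)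
    (h : ∀ z w : ℂ, ‖z‖ = 1 → P.evalEval z w = 0 → ‖Q.evalEval z w‖ ≤ M) {z w : ℂ}
    (hz : ‖z‖ ≤ 1) (hw : P.evalEval z w = 0) :
    ‖Q.evalEval z w‖ ≤ (1 + 2 ^ P.natDegree * P.natDegree) * M := by
  obtain ⟨χ, hχ, hd, h1, h2⟩ := exists_monic_fibre_values P Q hP
  set d := P.natDegree with hdd
  set t := Q.evalEval z w
  have hroot := h1 z w hw
  by_contra! hlt
  have htM : M < ‖t‖ := lt_of_le_of_lt (by nlinarith [show (0:ℝ) ≤ 2 ^ d * d by positivity]) hlt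
  have hco : ∀ i, ‖(χ.coeff i).eval z‖ ≤ M ^ (d - i) * 2 ^ d := by
    intro i
    refine norm_coeff_eval_le_of_sphere (fun z hz => ?_) hz
    have := coeff_le_of_roots_le (p := χ) (f := evalRingHom z) (B := M) i hχ
      (IsAlgClosed.splits _) (fun t ht => by
        have ht' := isRoot_of_mem_roots ht
        rw [IsRoot, map_evalRingHom_eval] at ht'
        obtain ⟨w, hw, rfl⟩ := h2 z t ht'
        exact h z w hz hw)
    rw [coeff_map, hd] at this
    refine this.trans (mul_le_mul_of_nonneg_left ?_ (by positivity))
    exact_mod_cast Nat.choose_le_two_pow _ _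
  have hd0 : d ≠ 0 := by
    intro hd0
    have : P = 1 := hP.natDegree_eq_zero.1 hd0
    rw [this] at hw
    simp at hw
  have hsum : t ^ d = - ∑ i ∈ Finset.range d, (χ.coeff i).eval z * t ^ i := by
    rw [← map_evalRingHom_eval, eval_eq_sum_range, hχ.natDegree_map, hd,
      Finset.sum_range_succ] at hroot
    have hc : (χ.map (evalRingHom z)).coeff d = 1 := by
      rw [coeff_map, ← hd, hχ.coeff_natDegree, map_one]
    rw [hc, one_mul] at hroot
    simp only [coeff_map, coe_evalRingHom] at hroot
    linear_combination hroot
  have hle : ‖t‖ ^ d ≤ ∑ i ∈ Finset.range d, 2 ^ d * M * ‖t‖ ^ (d - 1) := by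
    rw [← norm_pow, hsum, norm_neg]
    refine norm_sum_le_of_le _ fun i hi => ?_
    rw [Finset.mem_range] at hi
    rw [norm_mul, norm_pow]
    calc _ ≤ M ^ (d - i) * 2 ^ d * ‖t‖ ^ i := by gcongr; exact hco i
      _ = M ^ (d - 1 - i) * M * 2 ^ d * ‖t‖ ^ i := by
        rw [← pow_succ]; congr 4; omega
      _ ≤ ‖t‖ ^ (d - 1 - i) * M * 2 ^ d * ‖t‖ ^ i := by gcongr
      _ = 2 ^ d * M * (‖t‖ ^ (d - 1 - i) * ‖t‖ ^ i) := by ring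
      _ = _ := by rw [← pow_add]; congr 2; omega
  rw [Finset.sum_const, Finset.card_range, nsmul_eq_mul] at hle
  have ht0 : 0 < ‖t‖ := hM.trans htM
  have hp : ‖t‖ ^ d = ‖t‖ * ‖t‖ ^ (d - 1) := by rw [← pow_succ']; congr 1; omega
  have : ‖t‖ ≤ d * (2 ^ d * M) := by
    refine le_of_mul_le_mul_right (a := ‖t‖ ^ (d-1)) ?_ (by positivity)
    rw [← hp]; linarith
  nlinarith

open Polynomial in
/-- Maximum principle on a plane curve `P(z, w) = 0` with `P` monic in `w`. -/
lemma norm_le_of_sphere {P Q : ℂ[X][X]} (hP : P.Monic) {M : ℝ} (hM : 0 < M)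
    (h : ∀ z w : ℂ, ‖z‖ = 1 → P.evalEval z w = 0 → ‖Q.evalEval z w‖ ≤ M) {z w : ℂ}
    (hz : ‖z‖ ≤ 1) (hw : P.evalEval z w = 0) : ‖Q.evalEval z w‖ ≤ M := by
  by_contra! hlt
  set C : ℝ := 1 + 2 ^ P.natDegree * P.natDegree
  obtain ⟨m, hm⟩ := pow_unbounded_of_one_lt C ((one_lt_div hM).2 hlt)
  have := norm_le_mul_of_sphere (Q := Q ^ m) hP (pow_pos hM m) (fun z w hz hw => by
    rw [evalEval_pow, norm_pow]
    exact pow_le_pow_left₀ (norm_nonneg _) (h z w hz hw) m) hz hw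
  rw [evalEval_pow, norm_pow] at this
  rw [div_pow, lt_div_iff₀ (pow_pos hM m)] at hm
  linarith

lemma mem_slitPlane_of_norm_sub_one_lt {z : ℂ} (h : ‖z - 1‖ < 1) : z ∈ Complex.slitPlane := by
  simpa using Complex.mem_slitPlane_of_norm_lt_one h

/-- A nowhere vanishing continuous function on the closed unit disc has a continuous logarithm. -/
lemma exists_continuousOn_log_closedBall {ψ : ℂ → ℂ}
    (hψ : ContinuousOn ψ (Metric.closedBall 0 1))
    (h0 : ∀ x ∈ Metric.closedBall (0 : ℂ) 1, ψ x ≠ 0) :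
    ∃ L : ℂ → ℂ, ContinuousOn L (Metric.closedBall 0 1) ∧
      ∀ x ∈ Metric.closedBall (0 : ℂ) 1, Complex.exp (L x) = ψ x := by
  have hc : IsCompact (Metric.closedBall (0 : ℂ) 1) := isCompact_closedBall _ _
  obtain ⟨x0, hx0, hmin⟩ := hc.exists_isMinOn ⟨0, by simp⟩ hψ.norm
  have hm : 0 < ‖ψ x0‖ := norm_pos_iff.2 (h0 x0 hx0)
  obtain ⟨δ, hδ, hu⟩ := Metric.uniformContinuousOn_iff.1
    (hc.uniformContinuousOn_of_continuous hψ) _ hm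
  obtain ⟨N, hN⟩ := exists_nat_gt (1 / δ)
  have hNpos : (0 : ℝ) < N := (by positivity : 0 < 1 / δ).trans hN
  have hmem : ∀ j ≤ N, ∀ x ∈ Metric.closedBall (0 : ℂ) 1,
      ((j / N : ℝ) : ℂ) * x ∈ Metric.closedBall (0 : ℂ) 1 := by
    intro j hj x hx
    rw [mem_closedBall_zero_iff] at hx ⊢
    rw [norm_mul, Complex.norm_real, Real.norm_of_nonneg (by positivity)]
    have : (j / N : ℝ) ≤ 1 := by rw [div_le_one hNpos]; exact_mod_cast hj
    nlinarith [norm_nonneg x, (by positivity : (0:ℝ) ≤ j / N)]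
  have hslit : ∀ j < N, ∀ x ∈ Metric.closedBall (0 : ℂ) 1,
      ψ (((j + 1 : ℕ) / N : ℝ) * x) / ψ ((j / N : ℝ) * x) ∈ Complex.slitPlane := by
    intro j hj x hx
    have h1 := hmem j hj.le x hx
    have h2 := hmem (j + 1) hj x hx
    have hd : dist (((((j + 1 : ℕ) : ℝ) / N : ℝ) : ℂ) * x) (((j / N : ℝ) : ℂ) * x) < δ := by
      rw [dist_eq_norm, ← sub_mul, norm_mul, ← Complex.ofReal_sub, Complex.norm_real, ← sub_div]
      push_cast
      rw [add_sub_cancel_left, Real.norm_of_nonneg (by positivity)]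
      rw [mem_closedBall_zero_iff] at hx
      have : 1 / (N : ℝ) < δ := by
        rw [div_lt_iff₀ hδ] at hN
        rw [div_lt_iff₀ hNpos]; linarith
      nlinarith [(by positivity : (0:ℝ) ≤ 1 / N), norm_nonneg x]
    have h3 := hu _ h2 _ h1 hd
    have hne := h0 _ h1
    have h4 : ‖ψ x0‖ ≤ ‖ψ (((j / N : ℝ) : ℂ) * x)‖ := hmin h1
    apply mem_slitPlane_of_norm_sub_one_lt
    rw [div_sub_one hne, norm_div, div_lt_one (norm_pos_iff.2 hne), ← dist_eq_norm]
    linarith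
  refine ⟨fun x => Complex.log (ψ 0) + ∑ j ∈ Finset.range N,
    Complex.log (ψ (((j + 1 : ℕ) / N : ℝ) * x) / ψ ((j / N : ℝ) * x)), ?_, ?_⟩
  · refine continuousOn_const.add (continuousOn_finsetSum _ fun j hj => ?_)
    rw [Finset.mem_range] at hj
    refine ContinuousOn.clog (ContinuousOn.div ?_ ?_ ?_) (hslit j hj)
    · exact hψ.comp (by fun_prop) (hmem (j + 1) hj)
    · exact hψ.comp (by fun_prop) (hmem j hj.le)
    · intro x hx; exact h0 _ (hmem j hj.le x hx)
  · intro x hx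
    have key : ∀ n ≤ N, ψ 0 * ∏ j ∈ Finset.range n,
        (ψ (((j + 1 : ℕ) / N : ℝ) * x) / ψ ((j / N : ℝ) * x)) = ψ ((n / N : ℝ) * x) := by
      intro n
      induction n with
      | zero => simp
      | succ n ih =>
        intro hn
        rw [Finset.prod_range_succ, ← mul_assoc, ih (by omega)]
        exact mul_div_cancel₀ _ (h0 _ (hmem n (by omega) x hx))
    rw [Complex.exp_add, Complex.exp_log (h0 0 (by simp)), Complex.exp_sum]
    have : ∀ j ∈ Finset.range N, Complex.exp (Complex.log
        (ψ (((j + 1 : ℕ) / N : ℝ) * x) / ψ ((j / N : ℝ) * x))) =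
        ψ (((j + 1 : ℕ) / N : ℝ) * x) / ψ ((j / N : ℝ) * x) := fun j hj =>
      Complex.exp_log (Complex.slitPlane_ne_zero (hslit j (Finset.mem_range.1 hj) x hx))
    rw [Finset.prod_congr rfl this, key N le_rfl, div_self hNpos.ne']
    simp

/-- There is no continuous logarithm of the identity on the unit circle. -/
lemma not_exists_continuousOn_log_sphere {M : ℂ → ℂ} (hM : ContinuousOn M (Metric.sphere 0 1))
    (h : ∀ x ∈ Metric.sphere (0 : ℂ) 1, Complex.exp (M x) = x) : False := by
  have hmem : ∀ t : ℝ, Complex.exp (t * Complex.I) ∈ Metric.sphere (0 : ℂ) 1 := by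
    intro t; simp [Complex.norm_exp_ofReal_mul_I]
  set u : ℝ → ℂ := fun t => M (Complex.exp (t * Complex.I)) - t * Complex.I with hu
  have huc : Continuous u := by
    refine Continuous.sub ?_ (by fun_prop)
    exact hM.comp_continuous (by fun_prop) hmem
  have hexp : ∀ t, Complex.exp (u t) = 1 := by
    intro t
    rw [hu, Complex.exp_sub, h _ (hmem t), div_self (Complex.exp_ne_zero _)]
  have hcount : (Set.range u).Countable := by
    refine (Set.countable_range fun n : ℤ => n * (2 * Real.pi * Complex.I)).mono ?_
    rintro _ ⟨t, rfl⟩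
    obtain ⟨n, hn⟩ := Complex.exp_eq_one_iff.1 (hexp t)
    exact ⟨n, hn.symm⟩
  have hsub := hcount.isTotallyDisconnected _ subset_rfl (isPreconnected_range huc)
  have h1 := hsub ⟨0, rfl⟩ ⟨2 * Real.pi, rfl⟩
  simp only [hu, Complex.ofReal_zero, zero_mul, Complex.exp_zero, sub_zero, Complex.ofReal_mul,
    Complex.ofReal_ofNat, Complex.exp_two_pi_mul_I] at h1
  exact Complex.two_pi_I_ne_zero (by linear_combination h1)

/-- A continuous map of the closed unit disc that moves boundary points by at most `1 / 2` has a
zero. -/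
lemma exists_zero_of_dist_le {ψ : ℂ → ℂ} (hψ : ContinuousOn ψ (Metric.closedBall 0 1))
    (hd : ∀ x ∈ Metric.closedBall (0 : ℂ) 1, ‖ψ x - x‖ ≤ 1 / 2) :
    ∃ x ∈ Metric.closedBall (0 : ℂ) 1, ψ x = 0 := by
  by_contra! h0
  obtain ⟨L, hL, hexp⟩ := exists_continuousOn_log_closedBall hψ h0
  have hsub : Metric.sphere (0 : ℂ) 1 ⊆ Metric.closedBall 0 1 := Metric.sphere_subset_closedBall
  have hne : ∀ x ∈ Metric.sphere (0 : ℂ) 1, x ≠ 0 := by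
    rintro x hx rfl; simp at hx
  have hslit : ∀ x ∈ Metric.sphere (0 : ℂ) 1, ψ x / x ∈ Complex.slitPlane := by
    intro x hx
    apply mem_slitPlane_of_norm_sub_one_lt
    rw [div_sub_one (hne x hx), norm_div, mem_sphere_zero_iff_norm.1 hx, div_one]
    linarith [hd x (hsub hx)]
  refine not_exists_continuousOn_log_sphere (M := fun x => L x - Complex.log (ψ x / x)) ?_ ?_
  · exact (hL.mono hsub).sub (((hψ.mono hsub).div continuousOn_id hne).clog hslit)
  · intro x hx
    rw [Complex.exp_sub, hexp x (hsub hx), Complex.exp_log (Complex.slitPlane_ne_zero (hslit x hx)),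
      div_div_cancel₀ (h0 x (hsub hx))]

/-- If `g ^ k` stays close to a nonzero constant along a segment, then `g` changes along the
segment by a factor `exp (u / k)` with `u` bounded independently of `k`. -/
lemma exists_exp_div_of_segment {g : ℂ → ℂ} {x y : ℂ} {k : ℕ} (hk : k ≠ 0)
    (hg : ContinuousOn g (segment ℝ x y)) (hx : g x ≠ 0)
    (h : ∀ t ∈ segment ℝ x y, ‖g t ^ k / g x ^ k - 1‖ ≤ 1 / 2) :
    ∃ u : ℂ, ‖u‖ ≤ 1 ∧ g y = g x * Complex.exp (u / k) := by
  have hk' : (k : ℂ) ≠ 0 := Nat.cast_ne_zero.2 hk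
  set l : ℂ → ℂ := fun t => Complex.log (g t ^ k / g x ^ k) with hl
  have hslit : ∀ t ∈ segment ℝ x y, g t ^ k / g x ^ k ∈ Complex.slitPlane := fun t ht =>
    mem_slitPlane_of_norm_sub_one_lt (by linarith [h t ht])
  have hlc : ContinuousOn l (segment ℝ x y) := ((hg.pow k).div_const _).clog hslit
  set s : ℂ → ℂ := fun t => g t / g x * Complex.exp (-(l t / k)) with hs
  have hsc : ContinuousOn s (segment ℝ x y) := (hg.div_const _).mul (hlc.div_const _).neg.cexp
  have hsk : ∀ t ∈ segment ℝ x y, s t ^ k = 1 := by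
    intro t ht
    rw [hs, mul_pow, div_pow, ← Complex.exp_nat_mul, mul_neg, mul_div_cancel₀ _ hk',
      Complex.exp_neg, hl, Complex.exp_log (Complex.slitPlane_ne_zero (hslit t ht))]
    exact mul_inv_cancel₀ (Complex.slitPlane_ne_zero (hslit t ht))
  have hfin : (s '' segment ℝ x y).Finite := by
    refine Set.Finite.subset (Polynomial.nthRoots k (1 : ℂ)).toFinset.finite_toSet ?_
    rintro _ ⟨t, ht, rfl⟩
    simpa [Polynomial.mem_nthRoots (Nat.pos_of_ne_zero hk)] using hsk t ht
  have hpre : IsPreconnected (s '' segment ℝ x y) :=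
    (convex_segment x y).isPreconnected.image s hsc
  have heq : s y = s x := hfin.countable.isTotallyDisconnected _ subset_rfl hpre
    ⟨y, right_mem_segment ℝ x y, rfl⟩ ⟨x, left_mem_segment ℝ x y, rfl⟩
  have hsx : s x = 1 := by simp [hs, hl, div_self hx, div_self (pow_ne_zero k hx)]
  refine ⟨l y, ?_, ?_⟩
  · have h1 := h y (right_mem_segment ℝ x y)
    have h2 := Complex.norm_log_one_add_half_le_self h1
    rw [add_sub_cancel] at h2
    rw [hl]; linarith
  · rw [hsx, hs] at heq
    simp only [Complex.exp_neg] at heq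
    rw [← div_eq_mul_inv, div_eq_one_iff_eq (Complex.exp_ne_zero _), div_eq_iff hx] at heq
    rw [heq, mul_comm]

/-- A continuous function on the closed unit disc that is approximable by `k`-th powers for
arbitrarily large `k` has a continuous argument where it is bounded away from zero. -/
lemma exists_continuous_arg {q : ℂ → ℂ} (hq : ContinuousOn q (Metric.closedBall 0 1))
    (hpow : ∀ η > 0, ∀ N : ℕ, ∃ k ≥ N, ∃ g : ℂ → ℂ, ContinuousOn g (Metric.closedBall 0 1) ∧
      ∀ x ∈ Metric.closedBall (0 : ℂ) 1, ‖q x - g x ^ k‖ < η) {ε : ℝ} (hε : 0 < ε) :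
    ∃ θ : ℂ → ℝ, Continuous θ ∧ ∀ x ∈ Metric.closedBall (0 : ℂ) 1, ε ≤ ‖q x‖ →
      (‖q x‖ : ℂ) * Complex.exp (θ x * Complex.I) = q x := by
  have hc : IsCompact (Metric.closedBall (0 : ℂ) 1) := isCompact_closedBall _ _
  obtain ⟨δ, hδ, hu⟩ := Metric.uniformContinuousOn_iff.1
    (hc.uniformContinuousOn_of_continuous hq) (ε / 8) (by positivity)
  set K : Set ℂ := {x ∈ Metric.closedBall (0 : ℂ) 1 | ε ≤ ‖q x‖} with hK
  have hKB : K ⊆ Metric.closedBall (0 : ℂ) 1 := Set.sep_subset _ _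
  have hKclosed : IsClosed K :=
    (hq.norm.preimage_isClosed_of_isClosed hc.isClosed isClosed_Ici)
  have hKc : IsCompact K := hc.of_isClosed_subset hKclosed hKB
  let P : ℕ → (ℂ → ℂ) → Prop := fun k g => k ≠ 0 ∧ ContinuousOn g (Metric.closedBall 0 1) ∧
      ∀ x ∈ Metric.closedBall (0 : ℂ) 1, ‖q x - g x ^ k‖ < ε / 16
  have hgK : ∀ k g, P k g → ∀ x : K, ε / 2 ≤ ‖g x ^ k‖ := by
    intro k g hP x
    have h1 := hP.2.2 x x.2.1
    have h2 := x.2.2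
    have h3 := norm_sub_norm_le (q x) (g x ^ k)
    linarith
  have hgK0 : ∀ k g, P k g → ∀ x : K, g x ≠ 0 := by
    intro k g hP x h0
    have := hgK k g hP x
    rw [h0, zero_pow hP.1, norm_zero] at this
    linarith
  have hstep : ∀ x y : K, dist x y < δ → ∀ k g, P k g →
      ∃ u : ℂ, ‖u‖ ≤ 1 ∧ g y = g x * Complex.exp (u / k) := by
    intro x y hxy k g hP
    have hseg : segment ℝ (x : ℂ) y ⊆ Metric.closedBall 0 1 :=
      (convex_closedBall _ _).segment_subset x.2.1 y.2.1
    refine exists_exp_div_of_segment hP.1 (hP.2.1.mono hseg) (hgK0 k g hP x) fun t ht => ?_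
    have hne := pow_ne_zero k (hgK0 k g hP x)
    rw [div_sub_one hne, norm_div, div_le_iff₀ (norm_pos_iff.2 hne)]
    have htx : dist t x < δ := by
      refine lt_of_le_of_lt ?_ hxy
      have := (convex_closedBall (x : ℂ) (dist (x : ℂ) y)).segment_subset
        (Metric.mem_closedBall_self dist_nonneg)
        (by rw [Metric.mem_closedBall, dist_comm]) ht
      exact this
    have h1 := hu t (hseg ht) x x.2.1 htx
    have h2 := hP.2.2 t (hseg ht)
    have h3 := hP.2.2 x x.2.1
    have h4 := hgK k g hP x
    have h5 : ‖g t ^ k - g x ^ k‖ ≤ ‖q t - g t ^ k‖ + dist (q t) (q x) + ‖q x - g x ^ k‖ := by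
      rw [dist_eq_norm]
      calc _ = ‖-(q t - g t ^ k) + (q t - q x) + (q x - g x ^ k)‖ := by congr 1; ring
        _ ≤ _ := (norm_add₃_le).trans (by rw [norm_neg])
    linarith
  let r : K → K → Prop := fun x y => dist x y < δ
  have hchain : ∀ x y : K, Relation.EqvGen r x y → ∃ N : ℝ, ∀ k g, P k g →
      ∃ u : ℂ, ‖u‖ ≤ N ∧ g y = g x * Complex.exp (u / k) := by
    intro x y hxy
    induction hxy with
    | rel x y h => exact ⟨1, hstep x y h⟩
    | refl x => exact ⟨0, fun k g _ => ⟨0, by simp, by simp⟩⟩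
    | symm x y _ ih =>
      obtain ⟨N, hN⟩ := ih
      refine ⟨N, fun k g hP => ?_⟩
      obtain ⟨u, hu, h⟩ := hN k g hP
      refine ⟨-u, by rwa [norm_neg], ?_⟩
      rw [h, mul_assoc, ← Complex.exp_add]
      simp [neg_div]
    | trans x y z _ _ ih1 ih2 =>
      obtain ⟨N, hN⟩ := ih1
      obtain ⟨N', hN'⟩ := ih2
      refine ⟨N + N', fun k g hP => ?_⟩
      obtain ⟨u, hu, h⟩ := hN k g hP
      obtain ⟨u', hu', h'⟩ := hN' k g hP
      refine ⟨u + u', (norm_add_le _ _).trans (add_le_add hu hu'), ?_⟩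
      rw [h', h, mul_assoc, ← Complex.exp_add, add_div]
  let S : Setoid K := Relation.EqvGen.setoid r
  let rep : K → K := fun x => (Quotient.mk S x).out
  have hrep : ∀ x, Relation.EqvGen r (rep x) x := fun x => Quotient.mk_out (s := S) x
  have hrepeq : ∀ x y : K, dist x y < δ → rep x = rep y := by
    intro x y hxy
    have : Quotient.mk S x = Quotient.mk S y := Quotient.sound (Relation.EqvGen.rel x y hxy)
    simp only [rep, this]
  have hrepc : Continuous rep := by
    refine IsLocallyConstant.continuous ((IsLocallyConstant.iff_eventually_eq rep).2 fun x => ?_)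
    filter_upwards [Metric.ball_mem_nhds x hδ] with y hy
    exact hrepeq y x hy
  have hN : ∃ N : ℕ, ∀ x : K, ∀ k g, P k g →
      ∃ u : ℂ, ‖u‖ < N ∧ g x = g (rep x) * Complex.exp (u / k) := by
    have : CompactSpace K := isCompact_iff_compactSpace.1 hKc
    obtain ⟨t, -, htfin, ht⟩ := (isCompact_univ (X := K)).finite_cover_balls hδ
    choose N hN using fun x : K => hchain (rep x) x (hrep x)
    obtain ⟨b, hb⟩ := (htfin.image N).bddAbove
    obtain ⟨n, hn⟩ := exists_nat_gt (b + 1)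
    refine ⟨n, fun x k g hP => ?_⟩
    have hx := ht (Set.mem_univ x)
    simp only [Set.mem_iUnion, exists_prop] at hx
    obtain ⟨i, hi, hxi⟩ := hx
    have hd : dist i x < δ := by rw [dist_comm]; exact hxi
    obtain ⟨u, hu, h⟩ := hN i k g hP
    obtain ⟨u', hu', h'⟩ := hstep i x hd k g hP
    refine ⟨u + u', ?_, ?_⟩
    · have := hb ⟨i, hi, rfl⟩
      linarith [norm_add_le u u']
    · rw [h', h, ← hrepeq i x hd, mul_assoc, ← Complex.exp_add, add_div]
  obtain ⟨N, hN⟩ := hN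
  obtain ⟨k, hkN, g, hg, hgq⟩ := hpow (ε / 16) (by positivity) (N + 1)
  have hP : P k g := ⟨by omega, hg, hgq⟩
  have hkpos : (0 : ℝ) < k := by exact_mod_cast (by omega : 0 < k)
  have hgc : Continuous fun x : K => g x :=
    hg.comp_continuous continuous_subtype_val fun x => x.2.1
  have hqc : Continuous fun x : K => q x :=
    hq.comp_continuous continuous_subtype_val fun x => x.2.1
  have hslit1 : ∀ x : K, g x / g (rep x) ∈ Complex.slitPlane := by
    intro x
    obtain ⟨u, hu, h⟩ := hN x k g hP
    rw [h, mul_div_cancel_left₀ _ (hgK0 k g hP _), Complex.mem_slitPlane_iff]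
    left
    rw [Complex.exp_re]
    refine mul_pos (Real.exp_pos _) (Real.cos_pos_of_mem_Ioo ?_)
    have h1 : |(u / k).im| < 1 := by
      refine (Complex.abs_im_le_norm _).trans_lt ?_
      rw [norm_div, Complex.norm_natCast, div_lt_one hkpos]
      have : (N : ℝ) + 1 ≤ k := by exact_mod_cast hkN
      linarith
    rw [abs_lt] at h1
    constructor <;> linarith [Real.pi_gt_three, h1.1, h1.2]
  have hslit2 : ∀ x : K, q x / g x ^ k ∈ Complex.slitPlane := by
    intro x
    have hne := pow_ne_zero k (hgK0 k g hP x)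
    apply mem_slitPlane_of_norm_sub_one_lt
    rw [div_sub_one hne, norm_div, div_lt_one (norm_pos_iff.2 hne)]
    linarith [hgq x x.2.1, hgK k g hP x]
  have hargrep : Continuous fun x : K => Complex.arg (g (rep x) ^ k) := by
    refine IsLocallyConstant.continuous ((IsLocallyConstant.iff_eventually_eq _).2 fun x => ?_)
    filter_upwards [Metric.ball_mem_nhds x hδ] with y hy
    rw [hrepeq y x hy]
  let θ : C(K, ℝ) := ⟨fun x => k * Complex.arg (g x / g (rep x)) + Complex.arg (g (rep x) ^ k) +
      Complex.arg (q x / g x ^ k), by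
    refine ((continuous_const.mul ?_).add hargrep).add ?_
    · exact continuous_iff_continuousAt.2 fun x => (Complex.continuousAt_arg (hslit1 x)).comp
        (f := fun x : K => g x / g (rep x))
        (hgc.div (hgc.comp hrepc) fun x => hgK0 k g hP _).continuousAt
    · exact continuous_iff_continuousAt.2 fun x => (Complex.continuousAt_arg (hslit2 x)).comp
        (f := fun x : K => q x / g x ^ k)
        (hqc.div (hgc.pow k) fun x => pow_ne_zero k (hgK0 k g hP _)).continuousAt⟩
  obtain ⟨Θ, hΘ⟩ := ContinuousMap.exists_restrict_eq hKclosed θ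
  refine ⟨Θ, Θ.continuous, fun x hx hxε => ?_⟩
  have hxK : x ∈ K := ⟨hx, hxε⟩
  have hval : Θ x = θ ⟨x, hxK⟩ := by rw [← hΘ]; rfl
  have h1 := hgK0 k g hP ⟨x, hxK⟩
  have h2 := hgK0 k g hP (rep ⟨x, hxK⟩)
  have hprod : q x = (g x / g (rep ⟨x, hxK⟩)) ^ k * g (rep ⟨x, hxK⟩) ^ k * (q x / g x ^ k) := by
    rw [div_pow]
    field_simp
  rw [hval]
  conv_rhs => rw [hprod]
  conv_rhs => rw [← Complex.norm_mul_exp_arg_mul_I (g x / g (rep ⟨x, hxK⟩)),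
    ← Complex.norm_mul_exp_arg_mul_I (g (rep ⟨x, hxK⟩) ^ k),
    ← Complex.norm_mul_exp_arg_mul_I (q x / g x ^ k)]
  have hn : (‖q x‖ : ℂ) = (‖g x / g (rep ⟨x, hxK⟩)‖ : ℂ) ^ k * ‖g (rep ⟨x, hxK⟩) ^ k‖ *
      ‖q x / g x ^ k‖ := by
    conv_lhs => rw [hprod]
    rw [norm_mul, norm_mul, norm_pow]
    push_cast
    ring
  rw [hn, mul_pow, ← Complex.exp_nat_mul]
  simp only [θ, ContinuousMap.coe_mk, Complex.ofReal_add, Complex.ofReal_mul,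
    Complex.ofReal_natCast, add_mul, Complex.exp_add]
  rw [show (k : ℂ) * (Complex.arg (g x / g (rep ⟨x, hxK⟩)) : ℂ) * Complex.I =
    k * ((Complex.arg (g x / g (rep ⟨x, hxK⟩)) : ℂ) * Complex.I) by ring]
  ring

/-- Under the same hypothesis the function can be perturbed, only where it is small, to a nowhere
vanishing one. -/
lemma exists_perturbation_ne_zero {q : ℂ → ℂ} (hq : ContinuousOn q (Metric.closedBall 0 1))
    (hpow : ∀ η > 0, ∀ N : ℕ, ∃ k ≥ N, ∃ g : ℂ → ℂ, ContinuousOn g (Metric.closedBall 0 1) ∧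
      ∀ x ∈ Metric.closedBall (0 : ℂ) 1, ‖q x - g x ^ k‖ < η) {ε : ℝ} (hε : 0 < ε) :
    ∃ E : ℂ → ℂ, ContinuousOn E (Metric.closedBall 0 1) ∧
      ∀ x ∈ Metric.closedBall (0 : ℂ) 1, q x + E x ≠ 0 ∧ (ε ≤ ‖q x‖ → E x = 0) ∧
        (‖q x‖ < ε → ‖q x + E x‖ ≤ ε) := by
  obtain ⟨θ, hθ, h⟩ := exists_continuous_arg hq hpow hε
  refine ⟨fun x => (max ‖q x‖ ε : ℝ) * Complex.exp (θ x * Complex.I) - q x, ?_, ?_⟩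
  · refine ContinuousOn.sub (ContinuousOn.mul ?_ (by fun_prop)) hq
    exact (Complex.continuous_ofReal.comp (continuous_id.max continuous_const)).comp_continuousOn
      hq.norm
  · intro x hx
    refine ⟨?_, fun hx' => ?_, fun hx' => ?_⟩
    · rw [add_sub_cancel]
      refine mul_ne_zero ?_ (Complex.exp_ne_zero _)
      exact_mod_cast (lt_max_of_lt_right hε).ne'
    · simp only [max_eq_left hx', h x hx hx', sub_self]
    · rw [add_sub_cancel, norm_mul, Complex.norm_exp_ofReal_mul_I, mul_one, max_eq_right hx'.le,
        Complex.norm_real, Real.norm_of_nonneg hε.le]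

/-- A planar set on which the identity is approximable, up to `1 / 4`, by a continuous map with
finite range. -/
def FinelyDisconnected (W : Set ℂ) : Prop :=
  ∃ T : ℂ → ℂ, ContinuousOn T W ∧ (T '' W).Finite ∧ ∀ x ∈ W, dist (T x) x < 1 / 4

lemma FinelyDisconnected.mono {V W : Set ℂ} (hW : FinelyDisconnected W) (h : V ⊆ W) :
    FinelyDisconnected V := by
  obtain ⟨T, h1, h2, h3⟩ := hW
  exact ⟨T, h1.mono h, h2.subset (Set.image_mono h), fun x hx => h3 x (h hx)⟩

lemma finelyDisconnected_empty : FinelyDisconnected ∅ := ⟨id, by simp, by simp, by simp⟩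

lemma FinelyDisconnected.union {V W : Set ℂ} (hV : FinelyDisconnected V)
    (hW : FinelyDisconnected W) (hVc : IsClosed V) (hWc : IsClosed W) (hd : Disjoint V W) :
    FinelyDisconnected (V ∪ W) := by
  classical
  obtain ⟨T, h1, h2, h3⟩ := hV
  obtain ⟨T', h1', h2', h3'⟩ := hW
  have e1 : Set.EqOn (V.piecewise T T') T V := Set.piecewise_eqOn _ _ _
  have e2 : Set.EqOn (V.piecewise T T') T' W := fun x hx =>
    Set.piecewise_eq_of_notMem _ _ _ (Set.disjoint_right.1 hd hx)
  refine ⟨V.piecewise T T', (h1.congr e1).union_of_isClosed (h1'.congr e2) hVc hWc, ?_, ?_⟩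
  · rw [Set.image_union, e1.image_eq, e2.image_eq]
    exact h2.union h2'
  · rintro x (hx | hx)
    · rw [e1 hx]; exact h3 x hx
    · rw [e2 hx]; exact h3' x hx

lemma FinelyDisconnected.biUnion_finset {ι : Type*} (s : Finset ι) (W : ι → Set ℂ)
    (hW : ∀ i ∈ s, FinelyDisconnected (W i)) (hc : ∀ i ∈ s, IsClosed (W i))
    (hd : ∀ i ∈ s, ∀ j ∈ s, i ≠ j → Disjoint (W i) (W j)) :
    FinelyDisconnected (⋃ i ∈ s, W i) := by
  classical
  induction s using Finset.induction_on with
  | empty => simpa using finelyDisconnected_empty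
  | insert a s ha ih =>
    rw [Finset.set_biUnion_insert]
    refine (hW a (Finset.mem_insert_self _ _)).union
      (ih (fun i hi => hW i (Finset.mem_insert_of_mem hi))
        (fun i hi => hc i (Finset.mem_insert_of_mem hi))
        (fun i hi j hj => hd i (Finset.mem_insert_of_mem hi) j (Finset.mem_insert_of_mem hj)))
      (hc a (Finset.mem_insert_self _ _))
      (s.finite_toSet.isClosed_biUnion fun i hi => hc i (Finset.mem_insert_of_mem hi)) ?_
    rw [Set.disjoint_iUnion₂_right]
    intro i hi
    exact hd a (Finset.mem_insert_self _ _) i (Finset.mem_insert_of_mem hi)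
      (by rintro rfl; exact ha hi)

lemma IsTotallyDisconnected.finelyDisconnected {K : Set ℂ} (hK : IsCompact K)
    (hd : IsTotallyDisconnected K) : FinelyDisconnected K := by
  have : CompactSpace K := isCompact_iff_compactSpace.1 hK
  have : TotallyDisconnectedSpace K := totallyDisconnectedSpace_subtype_iff.2 hd
  have himg : ∀ C : Set K, IsClopen C → IsClosed (Subtype.val '' C) := fun C hC =>
    hK.isClosed.isClosedEmbedding_subtypeVal.isClosedMap _ hC.isClosed
  suffices h : ∃ C : Set K, IsClopen C ∧ Set.univ ⊆ C ∧ FinelyDisconnected (Subtype.val '' C) by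
    obtain ⟨C, -, hC, hf⟩ := h
    rw [Set.univ_subset_iff.1 hC, Set.image_univ, Subtype.range_coe] at hf
    exact hf
  refine isCompact_univ.induction_on
    (p := fun S => ∃ C : Set K, IsClopen C ∧ S ⊆ C ∧ FinelyDisconnected (Subtype.val '' C))
    ?_ ?_ ?_ ?_
  · exact ⟨∅, isClopen_empty, subset_rfl, by simpa using finelyDisconnected_empty⟩
  · rintro s t hst ⟨C, hC, h, hf⟩
    exact ⟨C, hC, hst.trans h, hf⟩
  · rintro s t ⟨C, hC, h, hf⟩ ⟨C', hC', h', hf'⟩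
    refine ⟨C ∪ C', hC.union hC', Set.union_subset_union h h', ?_⟩
    rw [← Set.union_sdiff_self, Set.image_union]
    refine hf.union (hf'.mono (Set.image_mono Set.sdiff_subset)) (himg _ hC)
      (himg _ (hC'.diff hC)) ?_
    exact (Set.disjoint_image_iff Subtype.val_injective).2 Set.disjoint_sdiff_right
  · intro x _
    obtain ⟨V, hV, hxV, hVb⟩ := compact_exists_isClopen_in_isOpen
      (Metric.isOpen_ball (x := x) (ε := 1 / 4)) (Metric.mem_ball_self (by norm_num))
    refine ⟨V, mem_nhdsWithin_of_mem_nhds (hV.isOpen.mem_nhds hxV), V, hV, subset_rfl,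
      fun _ => x, continuousOn_const, (Set.finite_singleton (x : ℂ)).subset ?_, ?_⟩
    · rintro _ ⟨y, -, rfl⟩; rfl
    · rintro _ ⟨y, hy, rfl⟩
      rw [dist_comm]
      exact hVb hy

/-- A continuous self-map of the plane collapsing a neighbourhood of a finite set onto that set. -/
lemma exists_continuous_collapse (A : Finset ℂ) :
    ∃ κ : ℂ → ℂ, Continuous κ ∧ (∀ a ∈ A, κ a = a) ∧
      ∃ U : Set ℂ, IsOpen U ∧ ↑A ⊆ U ∧ ∀ y ∈ U, κ y ∈ A := by
  classical
  induction A using Finset.induction_on with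
  | empty => exact ⟨id, continuous_id, by simp, ∅, isOpen_empty, by simp, by simp⟩
  | insert a A ha ih =>
    obtain ⟨κ, hκ, hκA, U, hU, hAU, hUA⟩ := ih
    obtain ⟨b, hb0, hb1, -⟩ := exists_continuous_zero_one_of_isClosed
      (A.finite_toSet.isClosed) (isClosed_singleton (x := a))
      (Set.disjoint_singleton_right.2 ha)
    let c : ℂ → ℝ := fun y => max 0 (min 1 (3 * b y - 1))
    have hc : Continuous c := by fun_prop
    have hc0 : ∀ y, b y < 1 / 3 → c y = 0 := fun y hy =>
      max_eq_left ((min_le_right _ _).trans (by linarith))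
    have hc1 : ∀ y, 2 / 3 < b y → c y = 1 := fun y hy => by
      simp only [c]
      rw [min_eq_left (by linarith), max_eq_right zero_le_one]
    have hbA : ∀ x ∈ A, b x = 0 := fun x hx => hb0 hx
    have hba : b a = 1 := hb1 rfl
    refine ⟨fun y => (1 - c y) * κ y + c y * a, by fun_prop, ?_,
      (U ∩ {y | b y < 1 / 3}) ∪ {y | 2 / 3 < b y}, ?_, ?_, ?_⟩
    · intro x hx
      rcases Finset.mem_insert.1 hx with rfl | hx
      · simp [hc1 x (by rw [hba]; norm_num)]
      · simp [hc0 x (by rw [hbA x hx]; norm_num), hκA x hx]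
    · exact (hU.inter (isOpen_lt b.continuous continuous_const)).union
        (isOpen_lt continuous_const b.continuous)
    · intro x hx
      rcases Finset.mem_insert.1 (Finset.mem_coe.1 hx) with rfl | hx
      · right; change 2 / 3 < b x; rw [hba]; norm_num
      · left; refine ⟨hAU hx, ?_⟩; change b x < 1 / 3; rw [hbA x hx]; norm_num
    · rintro y (⟨hyU, hy⟩ | hy)
      · simp only [hc0 y hy, Complex.ofReal_zero, sub_zero, one_mul, zero_mul, add_zero]
        exact Finset.mem_insert_of_mem (hUA y hyU)
      · simp [hc1 y hy]

lemma FinelyDisconnected.exists_isOpen {W : Set ℂ} (hW : FinelyDisconnected W) (hc : IsClosed W) :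
    ∃ (T : ℂ → ℂ) (O : Set ℂ) (A : Finset ℂ), Continuous T ∧ IsOpen O ∧ W ⊆ O ∧
      (∀ x ∈ O, T x ∈ A) ∧ ∀ x ∈ O, dist (T x) x < 1 / 4 := by
  obtain ⟨T, h1, h2, h3⟩ := hW
  obtain ⟨T₀, hT₀⟩ := ContinuousMap.exists_restrict_eq hc ⟨W.domRestrict T, h1.domRestrict⟩
  have hval : ∀ x ∈ W, T₀ x = T x := fun x hx => by
    have := congrArg (fun f : C(W, ℂ) => f ⟨x, hx⟩) hT₀
    exact this
  obtain ⟨κ, hκ, hκA, U, hU, hAU, hUA⟩ := exists_continuous_collapse h2.toFinset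
  rw [Set.Finite.coe_toFinset] at hAU
  have hTc : Continuous fun x => κ (T₀ x) := hκ.comp T₀.continuous
  refine ⟨fun x => κ (T₀ x), T₀ ⁻¹' U ∩ {x | dist (κ (T₀ x)) x < 1 / 4}, h2.toFinset, hTc, ?_, ?_,
    fun x hx => hUA _ hx.1, fun x hx => hx.2⟩
  · exact (hU.preimage T₀.continuous).inter
      (isOpen_lt (hTc.dist continuous_id) continuous_const)
  · intro x hx
    refine ⟨?_, ?_⟩
    · change T₀ x ∈ U
      rw [hval x hx]; exact hAU ⟨x, hx, rfl⟩
    · change dist (κ (T₀ x)) x < 1 / 4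
      rw [hval x hx, hκA _ (h2.mem_toFinset.2 ⟨x, hx, rfl⟩)]
      exact h3 x hx

open MeasureTheory in
lemma volume_segment_eq_zero (a b : ℂ) : volume (segment ℝ a b) = 0 := by
  rw [← convexHull_pair]
  refine measure_mono_null (convexHull_subset_affineSpan _)
    (Measure.addHaar_affineSubspace volume _ fun htop => ?_)
  have h := (collinear_iff_finrank_le_one (k := ℝ)).1 (collinear_pair ℝ a b)
  rw [← direction_affineSpan, htop, AffineSubspace.direction_top, finrank_top,
    Complex.finrank_real_complex] at h
  omega

/-- The closed unit disc is not the union of two closed finely disconnected sets. -/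
lemma not_closedBall_subset_union {V W : Set ℂ} (hV : FinelyDisconnected V)
    (hW : FinelyDisconnected W) (hVc : IsClosed V) (hWc : IsClosed W)
    (h : Metric.closedBall (0 : ℂ) 1 ⊆ V ∪ W) : False := by
  obtain ⟨T, O, A, hT, hO, hVO, hTA, hTd⟩ := hV.exists_isOpen hVc
  obtain ⟨T', O', A', hT', hO', hWO, hTA', hTd'⟩ := hW.exists_isOpen hWc
  have hB : IsClosed (Metric.closedBall (0 : ℂ) 1) := Metric.isClosed_closedBall
  obtain ⟨l, hl0, hl1, hl⟩ := exists_continuous_zero_one_of_isClosed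
    (hB.sdiff hO) (hB.sdiff hO') (by
      rw [Set.disjoint_left]
      rintro x ⟨hx, hxO⟩ ⟨-, hxO'⟩
      rcases h hx with hx | hx
      · exact hxO (hVO hx)
      · exact hxO' (hWO hx))
  set ψ : ℂ → ℂ := fun x => l x * T x + (1 - l x) * T' x with hψ
  have hcases : ∀ x ∈ Metric.closedBall (0 : ℂ) 1,
      ‖ψ x - x‖ ≤ 1 / 4 ∧ ψ x ∈ ⋃ a ∈ A ∪ A', ⋃ b ∈ A ∪ A', segment ℝ a b := by
    intro x hx
    simp only [Set.mem_iUnion]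
    by_cases hxO : x ∈ O
    · by_cases hxO' : x ∈ O'
      · have hseg : ψ x ∈ segment ℝ (T x) (T' x) :=
          ⟨l x, 1 - l x, (hl x).1, by linarith [(hl x).2], by ring, by simp [hψ]⟩
        refine ⟨?_, T x, Finset.mem_union_left _ (hTA x hxO), T' x,
          Finset.mem_union_right _ (hTA' x hxO'), hseg⟩
        have := (convex_closedBall x (1 / 4)).segment_subset (hTd x hxO).le (hTd' x hxO').le hseg
        rwa [Metric.mem_closedBall, dist_eq_norm] at this
      · have hlx : l x = 1 := hl1 ⟨hx, hxO'⟩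
        have hval : ψ x = T x := by simp [hψ, hlx]
        rw [hval, ← dist_eq_norm]
        exact ⟨(hTd x hxO).le, T x, Finset.mem_union_left _ (hTA x hxO), T x,
          Finset.mem_union_left _ (hTA x hxO), left_mem_segment _ _ _⟩
    · have hlx : l x = 0 := hl0 ⟨hx, hxO⟩
      have hxO' : x ∈ O' := by
        rcases h hx with h' | h'
        · exact absurd (hVO h') hxO
        · exact hWO h'
      have hval : ψ x = T' x := by simp [hψ, hlx]
      rw [hval, ← dist_eq_norm]
      exact ⟨(hTd' x hxO').le, T' x, Finset.mem_union_right _ (hTA' x hxO'), T' x,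
        Finset.mem_union_right _ (hTA' x hxO'), left_mem_segment _ _ _⟩
  obtain ⟨p, hp, hpS⟩ : ∃ p ∈ Metric.ball (0 : ℂ) (1 / 4),
      p ∉ ⋃ a ∈ A ∪ A', ⋃ b ∈ A ∪ A', segment ℝ a b := by
    by_contra! hcon
    have hzero : MeasureTheory.volume (⋃ a ∈ A ∪ A', ⋃ b ∈ A ∪ A', segment ℝ a b) = 0 := by
      exact (MeasureTheory.measure_biUnion_null_iff (A ∪ A').countable_toSet).2 fun a _ =>
        (MeasureTheory.measure_biUnion_null_iff (A ∪ A').countable_toSet).2 fun b _ =>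
          volume_segment_eq_zero a b
    exact (Metric.measure_ball_pos MeasureTheory.volume (0 : ℂ) (by norm_num : (0 : ℝ) < 1 / 4)).ne'
      (MeasureTheory.measure_mono_null hcon hzero)
  obtain ⟨x, hx, hx0⟩ := exists_zero_of_dist_le (ψ := fun x => ψ x - p)
    (Continuous.continuousOn (by fun_prop)) (fun x hx => by
      have h1 := (hcases x hx).1
      have h2 := mem_ball_zero_iff.1 hp
      calc ‖ψ x - p - x‖ = ‖(ψ x - x) - p‖ := by congr 1; ring
        _ ≤ _ := (norm_sub_le _ _).trans (by linarith))
  exact hpS (sub_eq_zero.1 hx0 ▸ (hcases x hx).2)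

/-- If the fibres of a continuous function on the closed unit disc are totally disconnected, then
sets on which the function has small oscillation are finely disconnected. -/
lemma exists_finelyDisconnected_of_dist_lt {f : ℂ → ℂ}
    (hf : ContinuousOn f (Metric.closedBall 0 1))
    (hd : ∀ c, IsTotallyDisconnected {x ∈ Metric.closedBall (0 : ℂ) 1 | f x = c}) :
    ∃ s > 0, ∀ W ⊆ Metric.closedBall (0 : ℂ) 1,
      (∀ x ∈ W, ∀ y ∈ W, dist (f x) (f y) < s) → FinelyDisconnected W := by
  have hB : IsCompact (Metric.closedBall (0 : ℂ) 1) := isCompact_closedBall _ _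
  have hloc : ∀ v, ∃ ρ > 0,
      FinelyDisconnected {x ∈ Metric.closedBall (0 : ℂ) 1 | f x ∈ Metric.ball v ρ} := by
    intro v
    have hK : IsClosed {x ∈ Metric.closedBall (0 : ℂ) 1 | f x = v} :=
      hf.preimage_isClosed_of_isClosed hB.isClosed (isClosed_singleton (x := v))
    obtain ⟨T, O, A, hT, hO, hKO, hTA, hTd⟩ :=
      ((hd v).finelyDisconnected (hB.of_isClosed_subset hK fun x hx => hx.1)).exists_isOpen hK
    have hC : IsClosed (f '' (Metric.closedBall 0 1 \ O)) :=
      ((hB.diff hO).image_of_continuousOn (hf.mono Set.sdiff_subset)).isClosed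
    have hv : v ∈ (f '' (Metric.closedBall 0 1 \ O))ᶜ := by
      rintro ⟨x, hx, rfl⟩
      exact hx.2 (hKO ⟨hx.1, rfl⟩)
    obtain ⟨ρ, hρ, hsub⟩ := Metric.isOpen_iff.1 hC.isOpen_compl v hv
    have hsubO : {x ∈ Metric.closedBall (0 : ℂ) 1 | f x ∈ Metric.ball v ρ} ⊆ O := by
      rintro x ⟨hx, hxv⟩
      by_contra hxO
      exact hsub hxv ⟨x, ⟨hx, hxO⟩, rfl⟩
    refine ⟨ρ, hρ, T, hT.continuousOn, A.finite_toSet.subset ?_, fun x hx => hTd x (hsubO hx)⟩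
    rintro _ ⟨x, hx, rfl⟩
    exact hTA x (hsubO hx)
  choose ρ hρ hfd using hloc
  obtain ⟨s, hs, hleb⟩ := lebesgue_number_lemma_of_metric (hB.image_of_continuousOn hf)
    (c := fun v => Metric.ball v (ρ v)) (fun v => Metric.isOpen_ball)
    (fun v _ => Set.mem_iUnion.2 ⟨v, Metric.mem_ball_self (hρ v)⟩)
  refine ⟨s, hs, fun W hW hsmall => ?_⟩
  rcases W.eq_empty_or_nonempty with rfl | ⟨x, hx⟩
  · exact finelyDisconnected_empty
  · obtain ⟨v, hv⟩ := hleb (f x) ⟨x, hW hx, rfl⟩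
    exact (hfd v).mono fun y hy => ⟨hW hy, hv (hsmall y hy x hx)⟩

lemma exists_perturbation_forall_ne {f : ℂ → ℂ} (hf : ContinuousOn f (Metric.closedBall 0 1))
    (hpow : ∀ c, ∀ η > 0, ∀ N : ℕ, ∃ k ≥ N, ∃ g : ℂ → ℂ, ContinuousOn g (Metric.closedBall 0 1) ∧
      ∀ x ∈ Metric.closedBall (0 : ℂ) 1, ‖f x - c - g x ^ k‖ < η)
    (A : Finset ℂ) {ε : ℝ} (hε : 0 < ε) (hA : ∀ a ∈ A, ∀ b ∈ A, a ≠ b → 2 * ε ≤ dist a b) :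
    ∃ F : ℂ → ℂ, ContinuousOn F (Metric.closedBall 0 1) ∧
      ∀ x ∈ Metric.closedBall (0 : ℂ) 1, dist (F x) (f x) ≤ 2 * ε ∧ ∀ a ∈ A, F x ≠ a := by
  choose E hEc hE using fun c => exists_perturbation_ne_zero (q := fun x => f x - c)
    (hf.sub continuousOn_const) (hpow c) hε
  refine ⟨fun x => f x + ∑ a ∈ A, E a x,
    hf.add (continuousOn_finsetSum _ fun a _ => hEc a), fun x hx => ?_⟩
  by_cases h : ∃ a ∈ A, ‖f x - a‖ < ε
  · obtain ⟨a, ha, hlt⟩ := h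
    have hfar : ∀ b ∈ A, b ≠ a → ε ≤ ‖f x - b‖ := by
      intro b hb hba
      have h1 := hA a ha b hb hba.symm
      have h2 := dist_triangle_left a b (f x)
      rw [dist_eq_norm (f x), dist_eq_norm (f x)] at h2
      linarith
    have hsum : ∑ b ∈ A, E b x = E a x :=
      Finset.sum_eq_single_of_mem a ha fun b hb hba => (hE b x hx).2.1 (hfar b hb hba)
    have hle := (hE a x hx).2.2 hlt
    have heq : f x + E a x - a = f x - a + E a x := by ring
    rw [← heq] at hle
    simp only [hsum]
    refine ⟨?_, fun b hb hFb => ?_⟩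
    · rw [dist_eq_norm]
      calc ‖f x + E a x - f x‖ = ‖(f x + E a x - a) - (f x - a)‖ := by congr 1; ring
        _ ≤ _ := (norm_sub_le _ _).trans (by linarith)
    · by_cases hba : b = a
      · subst hba
        apply (hE b x hx).1
        rw [← heq, hFb, sub_self]
      · have := hA b hb a ha hba
        rw [hFb] at hle
        rw [dist_eq_norm] at this
        linarith
  · push Not at h
    have hsum : ∑ b ∈ A, E b x = 0 := Finset.sum_eq_zero fun b hb => (hE b x hx).2.1 (h b hb)
    simp only [hsum, add_zero, dist_self]
    refine ⟨by positivity, fun a ha hfa => ?_⟩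
    have := h a ha
    rw [hfa, sub_self, norm_zero] at this
    linarith

/-- A continuous function on the closed unit disc all of whose translates are approximable by
powers of large exponent has a fibre that is not totally disconnected. -/
theorem not_forall_isTotallyDisconnected_fibre {f : ℂ → ℂ}
    (hf : ContinuousOn f (Metric.closedBall 0 1))
    (hpow : ∀ c, ∀ η > 0, ∀ N : ℕ, ∃ k ≥ N, ∃ g : ℂ → ℂ, ContinuousOn g (Metric.closedBall 0 1) ∧
      ∀ x ∈ Metric.closedBall (0 : ℂ) 1, ‖f x - c - g x ^ k‖ < η) :
    ¬ ∀ c, IsTotallyDisconnected {x ∈ Metric.closedBall (0 : ℂ) 1 | f x = c} := by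
  intro hd
  obtain ⟨s, hs, hsmall⟩ := exists_finelyDisconnected_of_dist_lt hf hd
  obtain ⟨R, hR⟩ := (isCompact_closedBall (0 : ℂ) 1).exists_bound_of_continuousOn hf
  obtain ⟨h, hh, hhs⟩ : ∃ h : ℝ, 0 < h ∧ s = 4 * h := ⟨s / 4, by positivity, by ring⟩
  obtain ⟨M, hM⟩ := exists_nat_gt ((R + h) / h)
  rw [div_lt_iff₀ hh] at hM
  let J : Finset (ℤ × ℤ) := Finset.Icc (-M : ℤ) M ×ˢ Finset.Icc (-M : ℤ) M
  let pt : ℤ × ℤ → ℂ := fun j => ⟨h * j.1, h * j.2⟩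
  obtain ⟨F, hFc, hF⟩ := exists_perturbation_forall_ne hf hpow (J.image pt)
    (ε := h / 4) (by positivity) (by
      intro a ha b hb hab
      obtain ⟨i, -, rfl⟩ := Finset.mem_image.1 ha
      obtain ⟨j, -, rfl⟩ := Finset.mem_image.1 hb
      have key : ∀ m n : ℤ, m ≠ n → h ≤ |h * (m : ℝ) - h * n| := by
        intro m n hmn
        rw [← mul_sub, abs_mul, abs_of_pos hh]
        have : (1 : ℝ) ≤ |(m : ℝ) - n| := by
          exact_mod_cast Int.one_le_abs (sub_ne_zero.2 hmn)
        nlinarith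
      rw [dist_eq_norm]
      by_cases h1 : i.1 = j.1
      · have h2 : i.2 ≠ j.2 := fun h2 => hab (by rw [Prod.ext h1 h2])
        have := (key _ _ h2).trans (Complex.abs_im_le_norm (pt i - pt j))
        linarith
      · have := (key _ _ h1).trans (Complex.abs_re_le_norm (pt i - pt j))
        linarith)
  have hFd : ∀ x ∈ Metric.closedBall (0 : ℂ) 1, dist (F x) (f x) ≤ h / 2 := fun x hx =>
    (hF x hx).1.trans (by linarith)
  let Q : ℤ × ℤ → Set ℂ := fun j =>
    Set.Icc (h * j.1) (h * (j.1 + 1)) ×ℂ Set.Icc (h * j.2) (h * (j.2 + 1))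
  let C : ℤ × ℤ → Set ℂ := fun j => Metric.closedBall 0 1 ∩ F ⁻¹' Q j
  have hCc : ∀ j, IsClosed (C j) := fun j =>
    hFc.preimage_isClosed_of_isClosed Metric.isClosed_closedBall
      (isClosed_Icc.reProdIm isClosed_Icc)
  have hCf : ∀ j, FinelyDisconnected (C j) := by
    intro j
    refine hsmall _ Set.inter_subset_left ?_
    rintro x ⟨hx, ⟨hxr, hxr'⟩, hxi, hxi'⟩ y ⟨hy, ⟨hyr, hyr'⟩, hyi, hyi'⟩
    have h1 := hFd x hx
    have h2 := hFd y hy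
    have h3 : dist (F x) (F y) ≤ h + h := by
      rw [dist_eq_norm]
      refine (Complex.norm_le_abs_re_add_abs_im _).trans (add_le_add ?_ ?_)
      · rw [Complex.sub_re, abs_le]; constructor <;> linarith
      · rw [Complex.sub_im, abs_le]; constructor <;> linarith
    have h4 := dist_triangle4 (f x) (F x) (F y) (f y)
    rw [dist_comm (f x) (F x)] at h4
    linarith
  have hdisj : ∀ i ∈ J, ∀ j ∈ J, i ≠ j → (i.1 + i.2) % 2 = (j.1 + j.2) % 2 →
      Disjoint (C i) (C j) := by
    intro i hi j hj hij hpar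
    rw [Set.disjoint_left]
    rintro x ⟨hx, ⟨hir, hir'⟩, hii, hii'⟩ ⟨-, ⟨hjr, hjr'⟩, hji, hji'⟩
    have key : ∀ {m n : ℤ} {t : ℝ}, h * m ≤ t → t ≤ h * (n + 1) → m ≤ n + 1 := by
      intro m n t h1 h2
      have := le_of_mul_le_mul_left (h1.trans h2) hh
      exact_mod_cast this
    have r1 := key hir hjr'
    have r2 := key hjr hir'
    have i1 := key hii hji'
    have i2 := key hji hii'
    have hne : i.1 ≠ j.1 ∨ i.2 ≠ j.2 := by
      by_contra! hcon
      exact hij (Prod.ext hcon.1 hcon.2)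
    have val : ∀ {m n : ℤ} {t : ℝ}, h * m ≤ t → t ≤ h * (m + 1) → h * n ≤ t → t ≤ h * (n + 1) →
        (m = n + 1 ∨ n = m + 1) → t = h * (max m n : ℤ) := by
      rintro m n t h1 h2 h3 h4 (rfl | rfl)
      · rw [max_eq_left (by omega)]
        push_cast at *
        linarith
      · rw [max_eq_right (by omega)]
        push_cast at *
        linarith
    refine (hF x hx).2 (pt (max i.1 j.1, max i.2 j.2)) (Finset.mem_image_of_mem _ ?_)
      (Complex.ext (val hir hir' hjr hjr' (by omega)) (val hii hii' hji hji' (by omega)))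
    simp only [J, Finset.mem_product, Finset.mem_Icc] at hi hj ⊢
    omega
  have hcol : ∀ r : ℤ, FinelyDisconnected (⋃ j ∈ J.filter (fun j => (j.1 + j.2) % 2 = r), C j) ∧
      IsClosed (⋃ j ∈ J.filter (fun j => (j.1 + j.2) % 2 = r), C j) := by
    refine fun r => ⟨.biUnion_finset _ _ (fun j _ => hCf j) (fun j _ => hCc j) ?_,
      isClosed_biUnion_finset fun j _ => hCc j⟩
    intro i hi j hj hij
    rw [Finset.mem_filter] at hi hj
    exact hdisj i hi.1 j hj.1 hij (hi.2.trans hj.2.symm)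
  refine not_closedBall_subset_union (hcol 0).1 (hcol 1).1 (hcol 0).2 (hcol 1).2 fun x hx => ?_
  have hnorm : ‖F x‖ ≤ R + h := by
    have h1 := hFd x hx
    have h2 := hR x hx
    rw [dist_eq_norm] at h1
    have := norm_le_norm_add_norm_sub' (F x) (f x)
    linarith
  have floor_spec : ∀ t : ℝ, |t| ≤ R + h → h * ⌊t / h⌋ ≤ t ∧ t ≤ h * (⌊t / h⌋ + 1) ∧
      -(M : ℤ) ≤ ⌊t / h⌋ ∧ ⌊t / h⌋ ≤ M := by
    intro t ht
    rw [abs_le] at ht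
    have h1 := Int.floor_le (t / h)
    have h2 := (Int.lt_floor_add_one (t / h)).le
    refine ⟨?_, ?_, ?_, ?_⟩
    · rwa [le_div_iff₀ hh, mul_comm] at h1
    · rwa [div_le_iff₀ hh, mul_comm] at h2
    · rw [Int.le_floor, le_div_iff₀ hh]
      push_cast
      linarith
    · have : (⌊t / h⌋ : ℝ) ≤ M := h1.trans (by rw [div_le_iff₀ hh]; linarith)
      exact_mod_cast this
  obtain ⟨r1, r2, r3, r4⟩ := floor_spec _ ((Complex.abs_re_le_norm _).trans hnorm)
  obtain ⟨i1, i2, i3, i4⟩ := floor_spec _ ((Complex.abs_im_le_norm _).trans hnorm)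
  have hmem : x ∈ C (⌊(F x).re / h⌋, ⌊(F x).im / h⌋) := ⟨hx, ⟨r1, r2⟩, i1, i2⟩
  have hJ : (⌊(F x).re / h⌋, ⌊(F x).im / h⌋) ∈ J := by
    simp only [J, Finset.mem_product, Finset.mem_Icc]
    exact ⟨⟨r3, r4⟩, i3, i4⟩
  rcases Int.emod_two_eq_zero_or_one (⌊(F x).re / h⌋ + ⌊(F x).im / h⌋) with hp | hp
  · exact Or.inl (Set.mem_biUnion (Finset.mem_filter.2 ⟨hJ, hp⟩) hmem)
  · exact Or.inr (Set.mem_biUnion (Finset.mem_filter.2 ⟨hJ, hp⟩) hmem)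

lemma Multiset.pow_card_lt_norm_prod_sub {s : Multiset ℂ} {w : ℂ} {r : ℝ} (hr : 0 ≤ r) (hs : s ≠ 0)
    (h : ∀ α ∈ s, r < ‖w - α‖) : r ^ card s < ‖(s.map fun α => w - α).prod‖ := by
  have key : r ^ card s ≤ ‖(s.map fun α => w - α).prod‖ ∧ 0 < ‖(s.map fun α => w - α).prod‖ ∧
      (s ≠ 0 → r ^ card s < ‖(s.map fun α => w - α).prod‖) := by
    clear hs
    induction s using Multiset.induction_on with
    | empty => simp
    | cons a s ih =>
      obtain ⟨h1, h2, -⟩ := ih fun α hα => h α (mem_cons_of_mem hα)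
      have ha := h a (mem_cons_self a s)
      have hlt : r ^ card (a ::ₘ s) < ‖((a ::ₘ s).map fun α => w - α).prod‖ := by
        rw [card_cons, map_cons, prod_cons, norm_mul, pow_succ']
        exact (mul_le_mul_of_nonneg_left h1 hr).trans_lt (mul_lt_mul_of_pos_right ha h2)
      exact ⟨hlt.le, (pow_nonneg hr _).trans_lt hlt, fun _ => hlt⟩
  exact key.2.2 hs

open Polynomial in
lemma Polynomial.Monic.exists_mem_roots_norm_sub_le {P : ℂ[X]} (hP : P.Monic)
    (hd : P.natDegree ≠ 0) {r : ℝ} (hr : 0 ≤ r) {w : ℂ} (hw : ‖P.eval w‖ ≤ r ^ P.natDegree) :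
    ∃ α ∈ P.roots, ‖w - α‖ ≤ r := by
  by_contra! h
  have hcard := splits_iff_card_roots.1 (IsAlgClosed.splits P)
  have := Multiset.pow_card_lt_norm_prod_sub hr
    (by rintro h0; rw [h0, Multiset.card_zero] at hcard; exact hd hcard.symm) h
  rw [hcard, ← (IsAlgClosed.splits P).eval_eq_prod_roots_of_monic hP] at this
  linarith

open Polynomial in
/-- A connected piece of a lemniscate `‖P‖ ≤ r ^ deg P` of a monic polynomial has diameter at most
`2 * deg P * r`. -/
lemma Polynomial.Monic.dist_le_of_isPreconnected {P : ℂ[X]} (hP : P.Monic)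
    (hd : P.natDegree ≠ 0) {r : ℝ} (hr : 0 ≤ r) {S : Set ℂ} (hS : IsPreconnected S)
    (hSP : ∀ w ∈ S, ‖P.eval w‖ ≤ r ^ P.natDegree) {u v : ℂ} (hu : u ∈ S) (hv : v ∈ S) :
    dist u v ≤ P.natDegree * (2 * r) := by
  have hI : Set.Icc 0 (dist u v) ⊆ (fun w => dist w u) '' S := by
    refine (hS.image _ (by fun_prop : Continuous fun w => dist w u).continuousOn).Icc_subset
      ⟨u, hu, dist_self u⟩ ⟨v, hv, dist_comm v u⟩
  have hcov : Set.Icc 0 (dist u v) ⊆ ⋃ α ∈ P.roots.toFinset, Metric.closedBall (dist α u) r := by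
    intro t ht
    obtain ⟨w, hw, rfl⟩ := hI ht
    obtain ⟨α, hα, hwα⟩ := hP.exists_mem_roots_norm_sub_le hd hr (hSP w hw)
    refine Set.mem_biUnion (Multiset.mem_toFinset.2 hα) ?_
    rw [Metric.mem_closedBall, Real.dist_eq]
    exact (abs_dist_sub_le w α u).trans (by rwa [dist_eq_norm])
  have hvol := (MeasureTheory.measure_mono hcov).trans
    (MeasureTheory.measure_biUnion_finset_le (μ := MeasureTheory.volume) _ _)
  simp only [Real.volume_Icc, Real.volume_closedBall, sub_zero, Finset.sum_const,
    nsmul_eq_mul] at hvol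
  rw [← ENNReal.ofReal_natCast, ← ENNReal.ofReal_mul (by positivity),
    ENNReal.ofReal_le_ofReal_iff (by positivity)] at hvol
  refine hvol.trans (mul_le_mul_of_nonneg_right ?_ (by positivity))
  exact_mod_cast (Multiset.toFinset_card_le _).trans (Polynomial.card_roots' P)

/-- The identification of polynomials in two variables with polynomials in the second variable
over polynomials in the first one. -/
noncomputable def MvPolynomial.toBivariate :
    MvPolynomial (Fin 2) ℂ →ₐ[ℂ] Polynomial (Polynomial ℂ) :=
  MvPolynomial.aeval ![Polynomial.C Polynomial.X, Polynomial.X]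

lemma MvPolynomial.evalEval_toBivariate (p : MvPolynomial (Fin 2) ℂ) (z w : ℂ) :
    (toBivariate p).evalEval z w = eval ![z, w] p := by
  have : (Polynomial.evalEvalRingHom z w).comp (toBivariate : _ →+* _) = eval ![z, w] := by
    apply MvPolynomial.ringHom_ext
    · intro c
      simp [toBivariate]
    · intro i
      fin_cases i <;> simp [toBivariate]
  exact congrArg (fun φ => φ p) this

open Polynomial in
lemma Polynomial.eval_map_evalRingHom (P : ℂ[X][X]) (z w : ℂ) :
    (P.map (evalRingHom z)).eval w = P.evalEval z w := by
  rw [eval_map, eval₂_evalRingHom]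

/-- The part over the closed unit disc of a decreasing intersection of tubes around the
zero sets of the polynomials `P n`. -/
def tubeIntersection (P : ℕ → MvPolynomial (Fin 2) ℂ) (ε : ℕ → ℝ) : Set (Fin 2 → ℂ) :=
  {x | ‖x 0‖ ≤ 1 ∧ ∀ n, ‖MvPolynomial.eval x (P n)‖ ≤ ε n}

/-- The part of `tubeIntersection P ε` over the unit circle. -/
def tubeIntersectionSphere (P : ℕ → MvPolynomial (Fin 2) ℂ) (ε : ℕ → ℝ) : Set (Fin 2 → ℂ) :=
  {x | ‖x 0‖ = 1 ∧ ∀ n, ‖MvPolynomial.eval x (P n)‖ ≤ ε n}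

/-- A sequence of monic polynomials in the second variable together with radii for which the
tubes `‖P n‖ ≤ ε n` decrease. -/
structure IsTubeSequence (P : ℕ → MvPolynomial (Fin 2) ℂ) (ε : ℕ → ℝ) : Prop where
  pos : ∀ n, 0 < ε n
  zero : P 0 = MvPolynomial.X 1
  step : ∀ n x, ‖x 0‖ ≤ 1 → ‖MvPolynomial.eval x (P (n + 1))‖ ≤ ε (n + 1) →
    ‖MvPolynomial.eval x (P n)‖ ≤ ε n
  monic : ∀ n, (P n).toBivariate.Monic
  natDegree_ne_zero : ∀ n, (P n).toBivariate.natDegree ≠ 0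

lemma isClosed_tube {K : Set ℂ} (hK : IsClosed K) (p : MvPolynomial (Fin 2) ℂ) (r : ℝ) :
    IsClosed {x : Fin 2 → ℂ | x 0 ∈ K ∧ ‖MvPolynomial.eval x p‖ ≤ r} :=
  (hK.preimage (continuous_apply 0)).inter
    (isClosed_le (MvPolynomial.continuous_eval _).norm continuous_const)

namespace IsTubeSequence

variable {P : ℕ → MvPolynomial (Fin 2) ℂ} {ε : ℕ → ℝ}

lemma isCompact_tube (h : IsTubeSequence P ε) {K : Set ℂ} (hK : IsClosed K)
    (hK1 : ∀ z ∈ K, ‖z‖ ≤ 1) : IsCompact {x | x 0 ∈ K ∧ ‖MvPolynomial.eval x (P 0)‖ ≤ ε 0} := by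
  refine Metric.isCompact_of_isClosed_isBounded (isClosed_tube hK _ _) ?_
  · refine (Metric.isBounded_closedBall (x := (0 : Fin 2 → ℂ)) (r := max 1 (ε 0))).subset ?_
    rintro x ⟨hx0, hx1⟩
    rw [h.zero, MvPolynomial.eval_X] at hx1
    rw [mem_closedBall_zero_iff, pi_norm_le_iff_of_nonneg (by positivity)]
    intro i
    fin_cases i
    · exact (hK1 _ hx0).trans (le_max_left _ _)
    · exact hx1.trans (le_max_right _ _)

lemma isCompact_sphere (h : IsTubeSequence P ε) : IsCompact (tubeIntersectionSphere P ε) := by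
  refine (h.isCompact_tube (K := Metric.sphere 0 1) Metric.isClosed_sphere
    fun z hz => (mem_sphere_zero_iff_norm.1 hz).le).of_isClosed_subset ?_
    fun x hx => ⟨mem_sphere_zero_iff_norm.2 hx.1, hx.2 0⟩
  have heq : tubeIntersectionSphere P ε =
      {x | ‖x 0‖ = 1} ∩ ⋂ n, {x | ‖MvPolynomial.eval x (P n)‖ ≤ ε n} := by
    ext x
    simp [tubeIntersectionSphere]
  rw [heq]
  exact (isClosed_eq (continuous_apply 0).norm continuous_const).inter
    (isClosed_iInter fun n => isClosed_le (MvPolynomial.continuous_eval _).norm continuous_const)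

lemma subset_polyHull (h : IsTubeSequence P ε) :
    tubeIntersection P ε ⊆ polyHull (tubeIntersectionSphere P ε) := by
  rintro y ⟨hy0, hy⟩ Q
  by_contra! hlt
  set M := sSup ((fun x => ‖MvPolynomial.eval x Q‖) '' tubeIntersectionSphere P ε) with hMdef
  have hM0 : 0 ≤ M := Real.sSup_nonneg (by rintro _ ⟨x, -, rfl⟩; exact norm_nonneg _)
  have hM : ∀ x ∈ tubeIntersectionSphere P ε, ‖MvPolynomial.eval x Q‖ ≤ M := fun x hx =>
    le_csSup (h.isCompact_sphere.image (MvPolynomial.continuous_eval Q).norm).bddAbove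
      ⟨x, hx, rfl⟩
  obtain ⟨M', hMM', hM'⟩ := exists_between hlt
  let t : ℕ → Set (Fin 2 → ℂ) := fun n =>
    {x | x 0 ∈ Metric.sphere (0 : ℂ) 1 ∧ ‖MvPolynomial.eval x (P n)‖ ≤ ε n} ∩
      {x | M' ≤ ‖MvPolynomial.eval x Q‖}
  have hclosed : IsClosed {x : Fin 2 → ℂ | M' ≤ ‖MvPolynomial.eval x Q‖} :=
    isClosed_le continuous_const (MvPolynomial.continuous_eval _).norm
  obtain ⟨n, hn⟩ : ∃ n, ¬ (t n).Nonempty := by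
    by_contra! hcon
    obtain ⟨x, hx⟩ := IsCompact.nonempty_iInter_of_sequence_nonempty_isCompact_isClosed t
      (fun n x hx => ⟨⟨hx.1.1, h.step n x (mem_sphere_zero_iff_norm.1 hx.1.1).le hx.1.2⟩, hx.2⟩)
      hcon
      ((h.isCompact_tube Metric.isClosed_sphere
        fun z hz => (mem_sphere_zero_iff_norm.1 hz).le).inter_right hclosed)
      (fun n => (isClosed_tube Metric.isClosed_sphere _ _).inter hclosed)
    rw [Set.mem_iInter] at hx
    have h1 := hM x ⟨mem_sphere_zero_iff_norm.1 (hx 0).1.1, fun n => (hx n).1.2⟩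
    have h2 : M' ≤ ‖MvPolynomial.eval x Q‖ := (hx 0).2
    linarith
  have hyv : ![y 0, y 1] = y := by
    ext i; fin_cases i <;> rfl
  let c : ℂ := MvPolynomial.eval y (P n)
  have hev : ∀ z w, ((P n).toBivariate - Polynomial.C (Polynomial.C c)).evalEval z w =
      MvPolynomial.eval ![z, w] (P n) - c := fun z w => by
    simp [MvPolynomial.evalEval_toBivariate]
  have := norm_le_of_sphere (P := (P n).toBivariate - Polynomial.C (Polynomial.C c))
    (Q := Q.toBivariate) ((h.monic n).sub_of_left ?_) (hM0.trans_lt hMM') ?_ hy0 (w := y 1) ?_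
  · rw [MvPolynomial.evalEval_toBivariate, hyv] at this
    linarith
  · refine Polynomial.degree_C_le.trans_lt ?_
    exact Polynomial.natDegree_pos_iff_degree_pos.1 (Nat.pos_of_ne_zero (h.natDegree_ne_zero n))
  · intro z w hz hw
    rw [hev, sub_eq_zero] at hw
    rw [MvPolynomial.evalEval_toBivariate]
    by_contra! hcon
    exact hn ⟨![z, w], ⟨mem_sphere_zero_iff_norm.2 hz, hw ▸ hy n⟩, hcon.le⟩
  · rw [hev, hyv, sub_self]

lemma polyHull_subset (h : IsTubeSequence P ε) :
    polyHull (tubeIntersectionSphere P ε) ⊆ tubeIntersection P ε := by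
  intro y hy
  refine ⟨?_, fun n => (hy (P n)).trans (Real.sSup_le ?_ (h.pos n).le)⟩
  · have := (hy (MvPolynomial.X 0)).trans (Real.sSup_le (a := 1) ?_ zero_le_one)
    · simpa using this
    · rintro _ ⟨x, hx, rfl⟩
      simpa using hx.1.le
  · rintro _ ⟨x, hx, rfl⟩
    exact hx.2 n

lemma exists_mem_zero (h : IsTubeSequence P ε) : ∃ x ∈ tubeIntersection P ε, x 0 = 0 := by
  have hne : ∀ n, {x : Fin 2 → ℂ | x 0 ∈ ({0} : Set ℂ) ∧
      ‖MvPolynomial.eval x (P n)‖ ≤ ε n}.Nonempty := by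
    intro n
    have hm := (h.monic n).map (Polynomial.evalRingHom 0)
    obtain ⟨w, hw⟩ := IsAlgClosed.exists_root
      ((P n).toBivariate.map (Polynomial.evalRingHom 0)) (by
        rw [Polynomial.degree_eq_natDegree hm.ne_zero, (h.monic n).natDegree_map]
        exact_mod_cast h.natDegree_ne_zero n)
    rw [Polynomial.IsRoot.def, Polynomial.eval_map_evalRingHom,
      MvPolynomial.evalEval_toBivariate] at hw
    exact ⟨![0, w], rfl, by rw [hw, norm_zero]; exact (h.pos n).le⟩
  obtain ⟨x, hx⟩ := IsCompact.nonempty_iInter_of_sequence_nonempty_isCompact_isClosed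
    (fun n => {x : Fin 2 → ℂ | x 0 ∈ ({0} : Set ℂ) ∧ ‖MvPolynomial.eval x (P n)‖ ≤ ε n})
    (fun n x hx => ⟨hx.1, h.step n x (by rw [Set.mem_singleton_iff.1 hx.1]; simp) hx.2⟩)
    hne (h.isCompact_tube isClosed_singleton (by simp))
    (fun n => isClosed_tube isClosed_singleton _ _)
  rw [Set.mem_iInter] at hx
  have hx0 : x 0 = 0 := (hx 0).1
  exact ⟨x, ⟨by rw [hx0]; simp, fun n => (hx n).2⟩, hx0⟩

lemma ssubset_polyHull (h : IsTubeSequence P ε) :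
    tubeIntersectionSphere P ε ⊂ polyHull (tubeIntersectionSphere P ε) := by
  refine ⟨fun x hx => h.subset_polyHull ⟨hx.1.le, hx.2⟩, fun hsub => ?_⟩
  obtain ⟨x, hx, hx0⟩ := h.exists_mem_zero
  have := (hsub (h.subset_polyHull hx)).1
  simp [hx0] at this

/-- If the tubes are thin relative to the degrees, then the fibres of their intersection over the
first coordinate are totally disconnected. -/
lemma isTotallyDisconnected_fibre (h : IsTubeSequence P ε)
    (hε : ∀ n : ℕ, ε n ≤ (1 / ((n + 1) * (P n).toBivariate.natDegree) : ℝ) ^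
      (P n).toBivariate.natDegree) (c : ℂ) :
    IsTotallyDisconnected {w : ℂ | ![c, w] ∈ tubeIntersection P ε} := by
  intro S hS hpre u hu v hv
  have hle : ∀ n : ℕ, dist u v ≤ 2 * (1 / ((n : ℝ) + 1)) := by
    intro n
    have hdeg := (h.monic n).natDegree_map (Polynomial.evalRingHom c)
    have hd : (0 : ℝ) < (P n).toBivariate.natDegree := by
      exact_mod_cast Nat.pos_of_ne_zero (h.natDegree_ne_zero n)
    refine (((h.monic n).map (Polynomial.evalRingHom c)).dist_le_of_isPreconnected
      (r := 1 / ((n + 1) * (P n).toBivariate.natDegree)) (by rw [hdeg]; exact h.natDegree_ne_zero n)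
      (by positivity) hpre (fun w hw => ?_) hu hv).trans (le_of_eq ?_)
    · rw [Polynomial.eval_map_evalRingHom, MvPolynomial.evalEval_toBivariate, hdeg]
      exact ((hS hw).2 n).trans (hε n)
    · rw [hdeg]
      field_simp
  have hlim := (tendsto_one_div_add_atTop_nhds_zero_nat (𝕜 := ℝ)).const_mul 2
  rw [mul_zero] at hlim
  exact dist_le_zero.1 (ge_of_tendsto' hlim hle)

end IsTubeSequence

open scoped Nat in
/-- Radii of the tubes around the zero sets of the polynomials `tubePoly a n`. -/
noncomputable def tubeRadius (a : ℕ → ℂ) : ℕ → ℝ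
  | 0 => 1
  | n + 1 => min (tubeRadius a n ^ (n + 2) / 2)
      (min (tubeRadius a n ^ (n + 2) / (2 * (1 + ‖a n‖)) / (n + 1))
        ((1 / ((n + 2 : ℕ) * ((n + 2)! : ℕ)) : ℝ) ^ (n + 2)!))

/-- The coefficient of `z - a n` in `tubePoly a (n + 1)`. -/
noncomputable def tubeSlope (a : ℕ → ℂ) (n : ℕ) : ℝ :=
  tubeRadius a n ^ (n + 2) / (2 * (1 + ‖a n‖))

/-- The polynomials `p₀ = w`, `pₙ₊₁ = pₙ ^ (n + 2) - δₙ (z - aₙ)`. -/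
noncomputable def tubePoly (a : ℕ → ℂ) : ℕ → MvPolynomial (Fin 2) ℂ
  | 0 => MvPolynomial.X 1
  | n + 1 => tubePoly a n ^ (n + 2) -
      MvPolynomial.C (tubeSlope a n : ℂ) * (MvPolynomial.X 0 - MvPolynomial.C (a n))

lemma tubeRadius_pos (a : ℕ → ℂ) (n : ℕ) : 0 < tubeRadius a n := by
  induction n with
  | zero => simp [tubeRadius]
  | succ n ih =>
    rw [tubeRadius]
    have : 0 < ((n + 2).factorial : ℝ) := by exact_mod_cast Nat.factorial_pos _
    refine lt_min (by positivity) (lt_min (by positivity) (by positivity))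

lemma tubeSlope_pos (a : ℕ → ℂ) (n : ℕ) : 0 < tubeSlope a n := by
  have := tubeRadius_pos a n
  unfold tubeSlope
  positivity

lemma tubeRadius_succ_le_slope (a : ℕ → ℂ) (n : ℕ) :
    tubeRadius a (n + 1) ≤ tubeSlope a n / (n + 1) := by
  rw [tubeRadius, tubeSlope]
  exact (min_le_right _ _).trans (min_le_left _ _)

lemma tubeRadius_le_pow_factorial (a : ℕ → ℂ) (n : ℕ) :
    tubeRadius a n ≤ (1 / ((n + 1) * (n + 1).factorial) : ℝ) ^ (n + 1).factorial := by
  cases n with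
  | zero => simp [tubeRadius]
  | succ n =>
    rw [tubeRadius]
    refine ((min_le_right _ _).trans (min_le_right _ _)).trans (le_of_eq ?_)
    push_cast
    ring_nf

lemma tubeRadius_succ_add_le (a : ℕ → ℂ) (n : ℕ) :
    tubeRadius a (n + 1) + tubeSlope a n * (1 + ‖a n‖) ≤ tubeRadius a n ^ (n + 2) := by
  have h1 : tubeRadius a (n + 1) ≤ tubeRadius a n ^ (n + 2) / 2 := by
    rw [tubeRadius]
    exact min_le_left _ _
  have h2 : tubeSlope a n * (1 + ‖a n‖) = tubeRadius a n ^ (n + 2) / 2 := by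
    have : 1 + ‖a n‖ ≠ 0 := by positivity
    rw [tubeSlope]
    field_simp
  linarith

lemma eval_tubePoly_succ (a : ℕ → ℂ) (n : ℕ) (x : Fin 2 → ℂ) :
    MvPolynomial.eval x (tubePoly a (n + 1)) =
      MvPolynomial.eval x (tubePoly a n) ^ (n + 2) - tubeSlope a n * (x 0 - a n) := by
  simp [tubePoly]

lemma monic_tubePoly_and_natDegree (a : ℕ → ℂ) (n : ℕ) : (tubePoly a n).toBivariate.Monic ∧
    (tubePoly a n).toBivariate.natDegree = (n + 1).factorial := by
  induction n with
  | zero =>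
    have : (tubePoly a 0).toBivariate = Polynomial.X := by
      simp [tubePoly, MvPolynomial.toBivariate]
    rw [this]
    exact ⟨Polynomial.monic_X, by simp⟩
  | succ n ih =>
    obtain ⟨q, hq⟩ : ∃ q : Polynomial ℂ, (tubePoly a (n + 1)).toBivariate =
        (tubePoly a n).toBivariate ^ (n + 2) - Polynomial.C q := by
      refine ⟨Polynomial.C (tubeSlope a n : ℂ) * (Polynomial.X - Polynomial.C (a n)), ?_⟩
      rw [tubePoly, map_sub, map_pow]
      congr 1
      simp [MvPolynomial.toBivariate]
    have hdeg : ((tubePoly a n).toBivariate ^ (n + 2)).natDegree = (n + 2).factorial := by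
      rw [ih.1.natDegree_pow, ih.2, Nat.factorial_succ (n + 1)]
    rw [hq, Polynomial.natDegree_sub_C, hdeg]
    refine ⟨(ih.1.pow _).sub_of_left (Polynomial.degree_C_le.trans_lt ?_), rfl⟩
    rw [← Polynomial.natDegree_pos_iff_degree_pos, hdeg]
    exact Nat.factorial_pos _

lemma isTubeSequence_tubePoly (a : ℕ → ℂ) : IsTubeSequence (tubePoly a) (tubeRadius a) where
  pos := tubeRadius_pos a
  zero := rfl
  step n x hx h := by
    rw [eval_tubePoly_succ] at h
    rw [← pow_le_pow_iff_left₀ (norm_nonneg _) (tubeRadius_pos a n).le (Nat.succ_ne_zero (n + 1)),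
      ← norm_pow]
    refine le_trans ?_ (tubeRadius_succ_add_le a n)
    refine (norm_le_norm_sub_add _ (tubeSlope a n * (x 0 - a n) : ℂ)).trans (add_le_add h ?_)
    rw [norm_mul, Complex.norm_real, Real.norm_of_nonneg (tubeSlope_pos a n).le]
    exact mul_le_mul_of_nonneg_left ((norm_sub_le _ _).trans (by gcongr)) (tubeSlope_pos a n).le
  monic n := (monic_tubePoly_and_natDegree a n).1
  natDegree_ne_zero n := by
    rw [(monic_tubePoly_and_natDegree a n).2]
    exact Nat.factorial_ne_zero _

lemma exists_norm_sub_pow_le (a : ℕ → ℂ) (n : ℕ) :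
    ∃ s : ℂ, ∀ x ∈ tubeIntersection (tubePoly a) (tubeRadius a),
      ‖x 0 - a n - (s * MvPolynomial.eval x (tubePoly a n)) ^ (n + 2)‖ ≤ 1 / (n + 1) := by
  have hpos := tubeSlope_pos a n
  have hδ : (tubeSlope a n : ℂ) ≠ 0 := by exact_mod_cast hpos.ne'
  obtain ⟨s, hs⟩ := IsAlgClosed.exists_pow_nat_eq ((tubeSlope a n : ℂ)⁻¹) (Nat.succ_pos (n + 1))
  refine ⟨s, fun x hx => ?_⟩
  have h1 := (hx.2 (n + 1)).trans (tubeRadius_succ_le_slope a n)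
  rw [eval_tubePoly_succ] at h1
  have h2 : x 0 - a n - (s * MvPolynomial.eval x (tubePoly a n)) ^ (n + 2) =
      -((tubeSlope a n : ℂ)⁻¹ * (MvPolynomial.eval x (tubePoly a n) ^ (n + 2) -
        tubeSlope a n * (x 0 - a n))) := by
    rw [mul_pow, hs]
    field_simp
    ring
  rw [h2, norm_neg, norm_mul, norm_inv, Complex.norm_real, Real.norm_of_nonneg hpos.le]
  calc (tubeSlope a n)⁻¹ * _ ≤ (tubeSlope a n)⁻¹ * (tubeSlope a n / (n + 1)) :=
        mul_le_mul_of_nonneg_left h1 (inv_nonneg.2 hpos.le)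
    _ = 1 / (n + 1) := by field_simp

lemma exists_seq_frequently_dist_lt :
    ∃ a : ℕ → ℂ, ∀ c, ∀ η > 0, ∀ N : ℕ, ∃ n ≥ N, dist c (a n) < η := by
  refine ⟨fun n => TopologicalSpace.denseSeq ℂ n.unpair.1, fun c η hη N => ?_⟩
  obtain ⟨m, hm⟩ := (TopologicalSpace.denseRange_denseSeq ℂ).exists_dist_lt c hη
  exact ⟨Nat.pair m N, Nat.right_le_pair m N, by simpa using hm⟩

/-- There is no continuous injection of the closed unit disc into `tubeIntersection`, when the
sequence `a` comes back close to every point infinitely often. -/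
lemma not_exists_injOn_mapsTo_tubeIntersection {a : ℕ → ℂ}
    (ha : ∀ c, ∀ η > 0, ∀ N : ℕ, ∃ n ≥ N, dist c (a n) < η) {φ : ℂ → Fin 2 → ℂ}
    (hφ : ContinuousOn φ (Metric.closedBall 0 1)) (hinj : Set.InjOn φ (Metric.closedBall 0 1))
    (hmaps : Set.MapsTo φ (Metric.closedBall 0 1)
      (tubeIntersection (tubePoly a) (tubeRadius a))) : False := by
  have hφi : ∀ i, ContinuousOn (fun x => φ x i) (Metric.closedBall 0 1) := fun i =>
    (continuous_apply i).comp_continuousOn hφ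
  refine not_forall_isTotallyDisconnected_fibre (hφi 0) ?_ ?_
  · intro c η hη N
    obtain ⟨K, hK⟩ := exists_nat_one_div_lt (half_pos hη)
    obtain ⟨n, hn, hcn⟩ := ha c (η / 2) (half_pos hη) (max N K)
    obtain ⟨s, hs⟩ := exists_norm_sub_pow_le a n
    refine ⟨n + 2, by have := le_max_left N K; omega,
      fun x => s * MvPolynomial.eval (φ x) (tubePoly a n),
      continuousOn_const.mul ((MvPolynomial.continuous_eval _).comp_continuousOn hφ),
      fun x hx => ?_⟩
    have h1 := hs _ (hmaps hx)
    have h2 : 1 / ((n : ℝ) + 1) ≤ 1 / (K + 1) :=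
      Nat.one_div_le_one_div ((le_max_right N K).trans hn)
    rw [dist_comm, dist_eq_norm] at hcn
    calc ‖φ x 0 - c - (s * MvPolynomial.eval (φ x) (tubePoly a n)) ^ (n + 2)‖
        = ‖(φ x 0 - a n - (s * MvPolynomial.eval (φ x) (tubePoly a n)) ^ (n + 2)) +
            (a n - c)‖ := by congr 1; ring
      _ < η := (norm_add_le _ _).trans_lt (by linarith)
  · intro c S hS hpre x hx y hy
    have hvec : ∀ z ∈ S, ![c, φ z 1] = φ z := fun z hz => by
      ext i
      fin_cases i
      · exact (hS hz).2.symm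
      · rfl
    have hsub := (isTubeSequence_tubePoly a).isTotallyDisconnected_fibre (fun n => by
        rw [(monic_tubePoly_and_natDegree a n).2]
        exact tubeRadius_le_pow_factorial a n) c ((fun z => φ z 1) '' S) (by
          rintro _ ⟨z, hz, rfl⟩
          change ![c, φ z 1] ∈ tubeIntersection _ _
          rw [hvec z hz]
          exact hmaps (hS hz).1)
      (hpre.image _ ((hφi 1).mono fun z hz => (hS hz).1))
    refine hinj (hS hx).1 (hS hy).1 ?_
    have hxy : φ x 1 = φ y 1 := hsub ⟨x, hx, rfl⟩ ⟨y, hy, rfl⟩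
    rw [← hvec x hx, ← hvec y hy, hxy]

/-- There exists a compact set `X ⊂ ℂ²` whose polynomial hull strictly contains `X` but
contains no subspace homeomorphic to the closed unit disc in ℝ². -/
theorem stmt_15 :
    ∃ X : Set (Fin 2 → ℂ), IsCompact X ∧ X ⊂ polyHull X ∧
      ∀ E : Set (Fin 2 → ℂ), E ⊆ polyHull X → ¬ Nonempty (↥E ≃ₜ ↥ClosedUnitDisc) := by
  obtain ⟨a, ha⟩ := exists_seq_frequently_dist_lt
  have h := isTubeSequence_tubePoly a
  refine ⟨_, h.isCompact_sphere, h.ssubset_polyHull, fun E hE => ?_⟩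
  rintro ⟨e⟩
  have hmem : ∀ x ∈ Metric.closedBall (0 : ℂ) 1,
      Complex.orthonormalBasisOneI.repr x ∈ ClosedUnitDisc := fun x hx => by
    rw [ClosedUnitDisc, mem_closedBall_zero_iff, LinearIsometryEquiv.norm_map]
    exact mem_closedBall_zero_iff.1 hx
  let ψ : Metric.closedBall (0 : ℂ) 1 → Fin 2 → ℂ := fun x =>
    e.symm ⟨Complex.orthonormalBasisOneI.repr x, hmem x x.2⟩
  have hψ : Continuous ψ := continuous_subtype_val.comp (e.symm.continuous.comp
    ((Complex.orthonormalBasisOneI.repr.continuous.comp continuous_subtype_val).subtype_mk _))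
  have hext : ∀ x, Function.extend Subtype.val ψ 0 (x : Metric.closedBall (0 : ℂ) 1) = ψ x :=
    fun x => Subtype.val_injective.extend_apply ψ 0 x
  refine not_exists_injOn_mapsTo_tubeIntersection ha (φ := Function.extend Subtype.val ψ 0)
    ?_ ?_ ?_
  · rw [continuousOn_iff_continuous_domRestrict]
    exact hψ.congr fun x => (hext x).symm
  · intro x hx y hy hxy
    rw [hext ⟨x, hx⟩, hext ⟨y, hy⟩] at hxy
    have := congrArg Subtype.val (e.symm.injective (Subtype.val_injective hxy))
    exact Complex.orthonormalBasisOneI.repr.injective this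
  · intro x hx
    rw [hext ⟨x, hx⟩]
    exact h.polyHull_subset (hE (e.symm _).2)
end

section
/- Let X ⊆ ℂ^N be compact and suppose the uniform algebra P(X) (the sup-norm closure in C(X, ℂ) of the polynomials) has dense invertibles. If K is a compact, locally connected subset of the polynomial hull X̂ with vanishing first Čech cohomology Ȟ¹(K, ℤ) = 0, then the covering dimension of K is at most 1. -/
/-- Lebesgue covering dimension of `X` is at most `n`: every open cover has an
open shrinking/refinement of order at most `n + 1`. -/
def CoveringDimLE (X : Type*) [TopologicalSpace X] (n : ℕ) : Prop :=
  ∀ (ι : Type) (U : ι → Set X), (∀ i, IsOpen (U i)) → (⋃ i, U i) = Set.univ →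
    ∃ V : ι → Set X, (∀ i, IsOpen (V i)) ∧ (⋃ i, V i) = Set.univ ∧
      (∀ i, V i ⊆ U i) ∧ ∀ x : X, {i | x ∈ V i}.Finite ∧ {i | x ∈ V i}.ncard ≤ n + 1

/-- For a compact Hausdorff space `E`, the vanishing of the first Čech cohomology
group `Ȟ¹(E, ℤ)` is equivalent (Bruschlinsky/Arens–Royden) to the statement that every
continuous nowhere-vanishing complex-valued function on `E` has a continuous logarithm. -/
def FirstCechH1Trivial (E : Type*) [TopologicalSpace E] : Prop :=
  ∀ g : C(E, ℂ), (∀ x, g x ≠ 0) → ∃ h : C(E, ℂ), ∀ x, g x = Complex.exp (h x)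

/-- `P(X)`: the closure in `C(X, ℂ)` (compact-open = sup-norm topology for compact `X`)
of the functions given by polynomials in `N` complex variables. -/
def polyAlg {N : ℕ} (X : Set (Fin N → ℂ)) : Set C(↥X, ℂ) :=
  closure {f : C(↥X, ℂ) | ∃ p : MvPolynomial (Fin N) ℂ,
    ∀ x : X, f x = MvPolynomial.eval (x : Fin N → ℂ) p}

section DenseInvertibles

open Set Filter Topology

theorem Polynomial.hasStrictFDerivAt_eval {A : Type*} [NormedCommRing A] [NormedAlgebra ℂ A]
    (p : Polynomial A) (x : A) :
    HasStrictFDerivAt (fun y => p.eval y)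
      (ContinuousLinearMap.mul ℂ A (p.derivative.eval x)) x := by
  induction p using Polynomial.induction_on' with
  | add p q hp hq => simpa using! hp.add hq
  | monomial n a =>
    have h := (hasStrictFDerivAt_pow (𝕜 := ℂ) n (x := x)).const_smul a
    simp only [Polynomial.eval_monomial]
    refine (h.congr_fderiv ?_)
    ext y
    simp [Polynomial.derivative_monomial]
    ring

/-- In a commutative Banach algebra with dense units, a polynomial with invertible top
coefficient takes invertible values on a dense set. -/
theorem dense_isUnit_eval {A : Type*} [NormedCommRing A] [NormedAlgebra ℂ A] [CompleteSpace A]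
    (hA : Dense {a : A | IsUnit a}) (n : ℕ) (p : Polynomial A) (hn : p.natDegree ≤ n)
    (hp : IsUnit (p.coeff n)) : Dense {c : A | IsUnit (p.eval c)} := by
  induction n generalizing p with
  | zero =>
    rw [Polynomial.eq_C_of_natDegree_le_zero hn]
    simp [hp]
  | succ n ih =>
    have hd : Dense {c : A | IsUnit (p.derivative.eval c)} := by
      apply ih
      · exact (Polynomial.natDegree_derivative_le p).trans (by omega)
      · rw [Polynomial.coeff_derivative]
        refine hp.mul ?_
        have : ((n : A) + 1) = algebraMap ℂ A ((n : ℂ) + 1) := by simp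
        rw [this]
        exact (IsUnit.mk0 _ (by exact_mod_cast Nat.succ_ne_zero n)).map _
    rw [dense_iff_inter_open]
    rintro U hU hne
    obtain ⟨c, hcU, u, hu⟩ := hd.inter_open_nonempty U hU hne
    have hstrict := p.hasStrictFDerivAt_eval c
    have hsurj : (ContinuousLinearMap.mul ℂ A (p.derivative.eval c)).range = ⊤ := by
      rw [LinearMap.range_eq_top]
      intro y
      exact ⟨↑u⁻¹ * y, by simp [← hu]⟩
    have hmap := hstrict.map_nhds_eq_of_surj hsurj
    have : (fun y => p.eval y) '' U ∈ 𝓝 (p.eval c) := by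
      rw [← hmap]
      exact image_mem_map (hU.mem_nhds hcU)
    obtain ⟨_, ⟨b, hb, rfl⟩, hbu⟩ := mem_closure_iff_nhds.1 (hA (p.eval c)) _ this
    exact ⟨b, hb, hbu⟩

variable {K : Type*} [TopologicalSpace K]

/-- Functions integral over a Banach function algebra with dense units are uniform limits of
nowhere-vanishing continuous functions. -/
theorem exists_ne_zero_near_of_isIntegral [CompactSpace K] (A : Subalgebra ℂ C(K, ℂ))
    [CompleteSpace A] (hA : Dense {a : A | IsUnit a}) (f : C(K, ℂ)) (hf : IsIntegral A f)
    (ε : ℝ) (hε : 0 < ε) : ∃ F : C(K, ℂ), (∀ x, F x ≠ 0) ∧ ∀ x, ‖F x - f x‖ < ε := by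
  obtain ⟨p, hp, hpf⟩ := hf
  have hd := dense_isUnit_eval hA p.natDegree p le_rfl (by simp [hp.coeff_natDegree])
  obtain ⟨c, hc, hu⟩ := hd.inter_open_nonempty (Metric.ball 0 ε) Metric.isOpen_ball
    ⟨0, by simpa using hε⟩
  refine ⟨f - (c : C(K, ℂ)), ?_, fun x => ?_⟩
  · have h1 : f - (c : C(K, ℂ)) ∣ (p.map (algebraMap A C(K, ℂ))).eval f
        - (p.map (algebraMap A C(K, ℂ))).eval (c : C(K, ℂ)) := Polynomial.sub_dvd_eval_sub _ _ _
    have h2 : (p.map (algebraMap A C(K, ℂ))).eval (c : C(K, ℂ))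
        = algebraMap A C(K, ℂ) (p.eval c) := by
      rw [Polynomial.eval_map]
      exact Polynomial.eval₂_at_apply (algebraMap A C(K, ℂ)) c
    rw [Polynomial.eval_map, hpf, h2, zero_sub, dvd_neg] at h1
    exact (ContinuousMap.isUnit_iff_forall_ne_zero _).1 (isUnit_of_dvd_unit h1 (hu.map _))
  · have : ‖(c : C(K, ℂ)) x‖ < ε :=
      (ContinuousMap.norm_coe_le_norm _ x).trans_lt (mem_ball_zero_iff.1 hc)
    simpa using this

theorem sub_eq_sub_of_exp_eq {S : Set K} (hS : IsPreconnected S) {L L' : K → ℂ}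
    (hL : ContinuousOn L S) (hL' : ContinuousOn L' S)
    (h : ∀ s ∈ S, Complex.exp (L s) = Complex.exp (L' s)) {x y : K} (hx : x ∈ S) (hy : y ∈ S) :
    L y - L x = L' y - L' x := by
  have hx0 := h x hx
  have key : EqOn (fun s => L s - L x) (fun s => L' s - L' x) S := by
    refine Complex.isCoveringMap_exp.eqOn_of_comp_eqOn hS (hL.sub continuousOn_const)
      (hL'.sub continuousOn_const) ?_ hx (by simp)
    intro s hs
    apply Subtype.ext
    simp [Complex.exp_sub, h s hs, hx0]
  exact key hy

/-- `x` and `y` lie in a connected set on which `g` is bounded away from zero. -/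
def JoinedOff (g : K → ℂ) (x y : K) : Prop :=
  ∃ S : Set K, IsPreconnected S ∧ x ∈ S ∧ y ∈ S ∧ ∃ δ > 0, ∀ s ∈ S, δ ≤ ‖g s‖

theorem JoinedOff.trans {g : K → ℂ} {x y z : K} (h : JoinedOff g x y) (h' : JoinedOff g y z) :
    JoinedOff g x z := by
  obtain ⟨S, hS, hx, hy, δ, hδ, h⟩ := h
  obtain ⟨T, hT, hy', hz, η, hη, h'⟩ := h'
  refine ⟨S ∪ T, hS.union y hy hy' hT, .inl hx, .inr hz, min δ η, lt_min hδ hη, ?_⟩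
  rintro s (hs | hs)
  · exact (min_le_left _ _).trans (h s hs)
  · exact (min_le_right _ _).trans (h' s hs)

theorem JoinedOff.ne_zero {g : K → ℂ} {x y : K} (h : JoinedOff g x y) : g y ≠ 0 := by
  obtain ⟨S, hS, hx, hy, δ, hδ, h⟩ := h
  exact norm_pos_iff.1 (hδ.trans_le (h y hy))

/-- `g` is a uniform limit of exponentials. -/
def ExpApprox (g : K → ℂ) : Prop :=
  ∀ ε > 0, ∃ h : C(K, ℂ), ∀ x, ‖Complex.exp (h x) - g x‖ < ε

theorem ExpApprox.exists_log {g : K → ℂ} (hg : ExpApprox g) (hc : Continuous g) {S : Set K}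
    {δ : ℝ} (hδ : 0 < δ) (hS : ∀ s ∈ S, δ ≤ ‖g s‖) :
    ∃ L : K → ℂ, ContinuousOn L S ∧ ∀ s ∈ S, Complex.exp (L s) = g s := by
  obtain ⟨h, hh⟩ := hg δ hδ
  have hne : ∀ s ∈ S, g s ≠ 0 := fun s hs => norm_pos_iff.1 (hδ.trans_le (hS s hs))
  have hslit : ∀ s ∈ S, Complex.exp (h s) / g s ∈ Complex.slitPlane := by
    intro s hs
    apply Complex.ball_one_subset_slitPlane
    have h0 : 0 < ‖g s‖ := norm_pos_iff.2 (hne s hs)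
    rw [mem_ball_iff_norm, div_sub_one (hne s hs), norm_div, div_lt_one h0]
    exact (hh s).trans_le (hS s hs)
  refine ⟨fun s => h s - Complex.log (Complex.exp (h s) / g s), ?_, fun s hs => ?_⟩
  · refine h.continuous.continuousOn.sub (ContinuousOn.clog ?_ hslit)
    exact (Complex.continuous_exp.comp h.continuous).continuousOn.div hc.continuousOn hne
  · rw [Complex.exp_sub, Complex.exp_log (div_ne_zero (Complex.exp_ne_zero _) (hne s hs))]
    have := hne s hs
    field_simp

theorem exists_isPreconnected_nhds [LocallyConnectedSpace K] {x : K} {U : Set K} (hU : U ∈ 𝓝 x) :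
    ∃ V ⊆ U, IsOpen V ∧ IsPreconnected V ∧ x ∈ V := by
  obtain ⟨V, hVU, hVo, hxV, hV⟩ := locallyConnectedSpace_iff_subsets_isOpen_isConnected.1 ‹_› x U hU
  exact ⟨V, hVU, hVo, hV.isPreconnected, hxV⟩

theorem exists_isPreconnected_bounded_below [LocallyConnectedSpace K] {g : K → ℂ}
    (hc : Continuous g) {x : K} (hx : g x ≠ 0) :
    ∃ V, IsOpen V ∧ IsPreconnected V ∧ x ∈ V ∧ ∃ δ > 0, ∀ s ∈ V, δ ≤ ‖g s‖ := by
  have h0 : 0 < ‖g x‖ := norm_pos_iff.2 hx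
  have : {s | ‖g x‖ / 2 < ‖g s‖} ∈ 𝓝 x :=
    (isOpen_lt continuous_const hc.norm).mem_nhds (by simpa using h0)
  obtain ⟨V, hVU, hVo, hV, hxV⟩ := exists_isPreconnected_nhds this
  exact ⟨V, hVo, hV, hxV, _, half_pos h0, fun s hs => (hVU hs).le⟩

/-- The normalised logarithm of `g` based at `x`, on the points joined to `x`. -/
theorem exists_based_log {g : K → ℂ} (hc : Continuous g) (hg : ExpApprox g) (x : K) :
    ∃ l : K → ℂ, ∀ S : Set K, IsPreconnected S → x ∈ S → ∀ δ > 0, (∀ s ∈ S, δ ≤ ‖g s‖) →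
      ∀ L : K → ℂ, ContinuousOn L S → (∀ s ∈ S, Complex.exp (L s) = g s) →
        ∀ y ∈ S, l y = L y - L x := by
  have key : ∀ y : K, ∃ w : ℂ, ∀ S : Set K, IsPreconnected S → x ∈ S → ∀ δ > 0,
      (∀ s ∈ S, δ ≤ ‖g s‖) → ∀ L : K → ℂ, ContinuousOn L S →
      (∀ s ∈ S, Complex.exp (L s) = g s) → y ∈ S → w = L y - L x := by
    intro y
    by_cases hy : JoinedOff g x y
    · obtain ⟨S, hS, hx, hyS, δ, hδ, h⟩ := hy
      obtain ⟨L, hL, hexp⟩ := hg.exists_log hc hδ h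
      refine ⟨L y - L x, fun T hT hxT η hη hT' M hM hMexp hyT => ?_⟩
      obtain ⟨N, hN, hNexp⟩ := hg.exists_log hc (S := S ∪ T) (lt_min hδ hη) (by
        rintro s (hs | hs)
        · exact (min_le_left _ _).trans (h s hs)
        · exact (min_le_right _ _).trans (hT' s hs))
      rw [sub_eq_sub_of_exp_eq hS hL (hN.mono subset_union_left)
          (fun s hs => (hexp s hs).trans (hNexp s (.inl hs)).symm) hx hyS,
        sub_eq_sub_of_exp_eq hT hM (hN.mono subset_union_right)
          (fun s hs => (hMexp s hs).trans (hNexp s (.inr hs)).symm) hxT hyT]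
    · exact ⟨0, fun S hS hx δ hδ h _ _ _ hyS => (hy ⟨S, hS, hx, hyS, δ, hδ, h⟩).elim⟩
  choose l hl using key
  exact ⟨l, fun S hS hx δ hδ h L hL hexp y hy => hl y S hS hx δ hδ h L hL hexp hy⟩

theorem exists_continuousOn_log_joinedOff [LocallyConnectedSpace K] {g : K → ℂ}
    (hc : Continuous g) (hg : ExpApprox g) (x : K) :
    ∃ l : K → ℂ, ContinuousOn l {y | JoinedOff g x y} ∧
      ∀ y, JoinedOff g x y → Complex.exp (l y) = g y / g x := by
  obtain ⟨l, hl⟩ := exists_based_log hc hg x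
  refine ⟨l, ?_, ?_⟩
  · intro y hy
    obtain ⟨V, hVo, hV, hyV, η, hη, hVη⟩ := exists_isPreconnected_bounded_below hc hy.ne_zero
    obtain ⟨S, hS, hx, hyS, δ, hδ, h⟩ := hy
    have hST : ∀ s ∈ S ∪ V, min δ η ≤ ‖g s‖ := by
      rintro s (hs | hs)
      · exact (min_le_left _ _).trans (h s hs)
      · exact (min_le_right _ _).trans (hVη s hs)
    obtain ⟨L, hL, hexp⟩ := hg.exists_log hc (lt_min hδ hη) hST
    have heq := hl (S ∪ V) (hS.union y hyS hyV hV) (.inl hx) _ (lt_min hδ hη) hST L hL hexp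
    have hLy : ContinuousAt L y :=
      hL.continuousAt (mem_of_superset (hVo.mem_nhds hyV) subset_union_right)
    refine ContinuousAt.continuousWithinAt ?_
    refine (hLy.sub (continuousAt_const (y := L x))).congr ?_
    filter_upwards [hVo.mem_nhds hyV] with z hz
    exact (heq z (.inr hz)).symm
  · rintro y ⟨S, hS, hx, hyS, δ, hδ, h⟩
    obtain ⟨L, hL, hexp⟩ := hg.exists_log hc hδ h
    rw [hl S hS hx δ hδ h L hL hexp y hyS, Complex.exp_sub, hexp y hyS, hexp x hx]

theorem isOpen_joinedOff [LocallyConnectedSpace K] {g : K → ℂ} (hc : Continuous g) (x : K) :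
    IsOpen {y | JoinedOff g x y} := by
  rw [isOpen_iff_mem_nhds]
  intro y hy
  obtain ⟨V, hVo, hV, hyV, η, hη, hVη⟩ := exists_isPreconnected_bounded_below hc hy.ne_zero
  exact mem_of_superset (hVo.mem_nhds hyV) fun z hz =>
    JoinedOff.trans hy ⟨V, hV, hyV, hz, η, hη, hVη⟩

theorem isClosed_joinedOff_inter [LocallyConnectedSpace K] {g : K → ℂ} (hc : Continuous g)
    (x : K) {δ : ℝ} (hδ : 0 < δ) : IsClosed {y | JoinedOff g x y ∧ δ ≤ ‖g y‖} := by
  have hW : IsOpen {y | g y ≠ 0 ∧ ¬ JoinedOff g x y} := by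
    rw [isOpen_iff_mem_nhds]
    rintro y ⟨hy0, hy⟩
    obtain ⟨V, hVo, hV, hyV, η, hη, hVη⟩ := exists_isPreconnected_bounded_below hc hy0
    exact mem_of_superset (hVo.mem_nhds hyV) fun z hz =>
      ⟨norm_pos_iff.1 (hη.trans_le (hVη z hz)),
        fun hz' => hy (hz'.trans ⟨V, hV, hz, hyV, η, hη, hVη⟩)⟩
  convert (isClosed_le continuous_const hc.norm : IsClosed {y | δ ≤ ‖g y‖}).inter
    hW.isClosed_compl using 1
  ext y
  simp only [mem_ofPred_eq, mem_inter_iff, mem_compl_iff, not_and, not_not]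
  constructor
  · rintro ⟨h, hy⟩
    exact ⟨hy, fun _ => h⟩
  · rintro ⟨hy, h⟩
    exact ⟨h (norm_pos_iff.1 (hδ.trans_le hy)), hy⟩

/-- An approximate indicator function of the points joined to `x`, built from a root of `g`. -/
theorem exists_root_near_indicator [CompactSpace K] [LocallyConnectedSpace K] {g : K → ℂ}
    (hc : Continuous g) (hg : ExpApprox g) (x : K) {η δ : ℝ} (hη : 0 < η) (hδ : 0 < δ) :
    ∃ (q : C(K, ℂ)) (k : ℕ), 0 < k ∧ (∀ y, JoinedOff g x y → q y ^ k = g y / g x) ∧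
      (∀ y, ¬ JoinedOff g x y → q y = 0) ∧ (∀ y, ‖q y‖ ≤ 2) ∧
      ∀ y, JoinedOff g x y → δ ≤ ‖g y‖ → ‖q y - 1‖ ≤ η := by
  classical
  obtain ⟨l, hl, hexp⟩ := exists_continuousOn_log_joinedOff hc hg x
  obtain ⟨C, hC⟩ : ∃ C, ∀ y, JoinedOff g x y → δ ≤ ‖g y‖ → ‖l y‖ ≤ C := by
    obtain ⟨C, hC⟩ := (isClosed_joinedOff_inter hc x hδ).isCompact.exists_bound_of_continuousOn
      (hl.mono fun y hy => hy.1)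
    exact ⟨C, fun y h h' => hC y ⟨h, h'⟩⟩
  obtain ⟨D, hD⟩ : ∃ D, ∀ y, ‖g y / g x‖ ≤ D := by
    obtain ⟨D, hD⟩ := (isCompact_univ (X := K)).exists_bound_of_continuousOn
      (hc.div_const (g x)).continuousOn
    exact ⟨D, fun y => hD y (mem_univ y)⟩
  obtain ⟨ρ, hρ, hρexp⟩ : ∃ ρ > 0, ∀ z : ℂ, ‖z‖ < ρ → ‖Complex.exp z - 1‖ < η := by
    have := Metric.continuousAt_iff.1 (Complex.continuous_exp.continuousAt (x := 0)) η hη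
    simpa [dist_eq_norm] using this
  obtain ⟨k₁, hk₁⟩ := exists_nat_gt (C / ρ)
  obtain ⟨k₂, hk₂⟩ := pow_unbounded_of_one_lt D (one_lt_two (α := ℝ))
  set k := max k₁ k₂ + 1 with hk
  have hk0 : (0 : ℝ) < k := by positivity
  have hkc : (k : ℂ) ≠ 0 := by exact_mod_cast hk0.ne'
  let q : K → ℂ := fun y => if JoinedOff g x y then Complex.exp (l y / k) else 0
  have hq1 : ∀ y, JoinedOff g x y → q y = Complex.exp (l y / k) := fun y h => if_pos h
  have hq0 : ∀ y, ¬ JoinedOff g x y → q y = 0 := fun y h => if_neg h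
  have hqk : ∀ y, JoinedOff g x y → q y ^ k = g y / g x := by
    intro y h
    rw [hq1 y h, ← Complex.exp_nat_mul, mul_div_cancel₀ _ hkc, hexp y h]
  have hqle : ∀ y, ‖q y‖ ^ k ≤ ‖g y / g x‖ := by
    intro y
    by_cases h : JoinedOff g x y
    · rw [← norm_pow, hqk y h]
    · rw [hq0 y h, norm_zero, zero_pow (by omega)]
      positivity
  have hqc : Continuous q := by
    rw [continuous_iff_continuousAt]
    intro y
    by_cases h : JoinedOff g x y
    · have hU := (isOpen_joinedOff hc x).mem_nhds h
      refine ((Complex.continuous_exp.continuousAt.comp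
        ((hl.continuousAt hU).div_const (k : ℂ)))).congr ?_
      filter_upwards [hU] with z hz
      exact (hq1 z hz).symm
    · by_cases h0 : g y = 0
      · have ht : Tendsto (fun z => ‖q z‖ ^ k) (𝓝 y) (𝓝 0) := by
          refine squeeze_zero (fun z => by positivity) hqle ?_
          have := ((hc.div_const (g x)).norm).tendsto y
          simpa [h0] using this
        have ht' : Tendsto (fun z => ‖q z‖) (𝓝 y) (𝓝 0) := by
          rw [Metric.tendsto_nhds] at ht ⊢
          intro ε hε
          filter_upwards [ht (ε ^ k) (by positivity)] with z hz
          simp only [dist_zero_right, norm_pow, norm_norm] at hz ⊢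
          exact lt_of_pow_lt_pow_left₀ k hε.le hz
        change Tendsto q (𝓝 y) (𝓝 (q y))
        rw [hq0 y h]
        exact tendsto_zero_iff_norm_tendsto_zero.2 ht'
      · obtain ⟨V, hVo, hV, hyV, e, he, hVe⟩ := exists_isPreconnected_bounded_below hc h0
        refine (continuousAt_const (y := (0 : ℂ))).congr ?_
        filter_upwards [hVo.mem_nhds hyV] with z hz
        exact (hq0 z fun hz' => h (hz'.trans ⟨V, hV, hz, hyV, e, he, hVe⟩)).symm
  refine ⟨⟨q, hqc⟩, k, by omega, hqk, hq0, fun y => ?_, fun y h hy => ?_⟩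
  · have h1 : ‖q y‖ ^ k ≤ 2 ^ k := by
      refine (hqle y).trans ((hD y).trans (hk₂.le.trans ?_))
      exact pow_le_pow_right₀ one_le_two (by omega)
    exact le_of_pow_le_pow_left₀ (by omega) zero_le_two h1
  · change ‖q y - 1‖ ≤ η
    rw [hq1 y h]
    refine (hρexp _ ?_).le
    rw [norm_div, Complex.norm_natCast, div_lt_iff₀ hk0]
    have h2 : (k₁ : ℝ) ≤ k := by exact_mod_cast (by omega : k₁ ≤ k)
    calc ‖l y‖ ≤ C := hC y h hy
      _ < k₁ * ρ := (div_lt_iff₀ hρ).1 hk₁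
      _ ≤ ρ * k := by nlinarith

theorem exists_continuousAt_log_div {f : K → ℂ} (hc : Continuous f)
    (hf : ∀ c : ℂ, ExpApprox fun p => f p - c) (x y : K) :
    ∃ D : ℂ → ℂ, ∀ c, JoinedOff (fun p => f p - c) x y → ContinuousAt D c ∧
      Complex.exp (D c) = (f y - c) / (f x - c) := by
  have hcc : ∀ c : ℂ, Continuous fun p => f p - c := fun c => hc.sub continuous_const
  choose l hl using fun c => exists_based_log (hcc c) (hf c) x
  refine ⟨fun c => l c y, ?_⟩
  rintro c ⟨S, hS, hx, hy, δ, hδ, h⟩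
  obtain ⟨L, hL, hexp⟩ := (hf c).exists_log (hcc c) hδ h
  have hne : ∀ s ∈ S, f s - c ≠ 0 := fun s hs => norm_pos_iff.1 (hδ.trans_le (h s hs))
  have hslit : ∀ b ∈ Metric.ball c (δ / 2), ∀ s ∈ S, (f s - b) / (f s - c) ∈ Complex.slitPlane := by
    intro b hb s hs
    apply Complex.ball_one_subset_slitPlane
    rw [mem_ball_iff_norm, div_sub_one (hne s hs), norm_div,
      div_lt_one (norm_pos_iff.2 (hne s hs))]
    rw [mem_ball_iff_norm, norm_sub_rev] at hb
    have := h s hs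
    have h3 : f s - b - (f s - c) = c - b := by ring
    rw [h3]
    linarith
  have heq : ∀ b ∈ Metric.ball c (δ / 2), l b y =
      (L y + Complex.log ((f y - b) / (f y - c))) -
        (L x + Complex.log ((f x - b) / (f x - c))) := by
    intro b hb
    refine hl b S hS hx (δ / 2) (half_pos hδ) ?_
      (fun s => L s + Complex.log ((f s - b) / (f s - c))) ?_ ?_ y hy
    · intro s hs
      rw [mem_ball_iff_norm] at hb
      have h1 := norm_sub_norm_le (f s - c) (b - c)
      have h2 := h s hs
      have h3 : f s - c - (b - c) = f s - b := by ring
      rw [h3] at h1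
      linarith
    · refine hL.add (ContinuousOn.clog ?_ (hslit b hb))
      exact (hcc b).continuousOn.div (hcc c).continuousOn hne
    · intro s hs
      rw [Complex.exp_add, hexp s hs, Complex.exp_log (Complex.slitPlane_ne_zero (hslit b hb s hs)),
        mul_div_cancel₀ _ (hne s hs)]
  have hball := Metric.ball_mem_nhds c (half_pos hδ)
  refine ⟨?_, ?_⟩
  · have hlog : ∀ s ∈ S, ContinuousAt (fun b => L s + Complex.log ((f s - b) / (f s - c))) c :=
      fun s hs => continuousAt_const.add (ContinuousAt.clog
        ((continuousAt_const.sub continuousAt_id).div_const _)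
        (hslit c (mem_of_mem_nhds hball) s hs))
    exact ((hlog y hy).sub (hlog x hx)).congr (eventually_of_mem hball fun b hb => (heq b hb).symm)
  · change Complex.exp (l c y) = _
    rw [hl c S hS hx δ hδ h L hL hexp y hy, Complex.exp_sub, hexp y hy, hexp x hx]

/-- Two points with different values under `f` are separated by a level set of `f` at a value on
each small circle around `f x`. -/
theorem exists_not_joinedOff_sub {f : K → ℂ} (hc : Continuous f)
    (hf : ∀ c : ℂ, ExpApprox fun p => f p - c) {x y : K} {r : ℝ} (hr : 0 < r)
    (hrd : r < ‖f y - f x‖) : ∃ c : ℂ, ‖c - f x‖ = r ∧ ¬ JoinedOff (fun p => f p - c) x y := by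
  by_contra! hcon
  obtain ⟨D, hD⟩ := exists_continuousAt_log_div hc hf x y
  have hcont := fun c hcr => hD c (hcon c hcr)
  set d : ℂ := f y - f x with hd
  have hd0 : d ≠ 0 := norm_pos_iff.1 (hr.trans hrd)
  have hrc : (r : ℂ) ≠ 0 := by exact_mod_cast hr.ne'
  let e : ℝ → ℂ := fun t => Complex.exp (t * Complex.I)
  have he : Continuous e := by fun_prop
  have hen : ∀ t, ‖e t‖ = 1 := fun t => Complex.norm_exp_ofReal_mul_I t
  have he0 : ∀ t, e t ≠ 0 := fun t => Complex.exp_ne_zero _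
  let γ : ℝ → ℂ := fun t => f x + r * e t
  have hγ : ∀ t, ‖γ t - f x‖ = r := by
    intro t
    simp [γ, hen, abs_of_pos hr]
  have hslit : ∀ t, 1 - r / d * e t ∈ Complex.slitPlane := by
    intro t
    apply Complex.ball_one_subset_slitPlane
    rw [mem_ball_iff_norm]
    simp only [sub_sub_cancel_left, norm_neg, norm_mul, norm_div, hen, mul_one, Complex.norm_real,
      Real.norm_eq_abs, abs_of_pos hr]
    rwa [div_lt_one (norm_pos_iff.2 hd0)]
  let N : ℝ → ℂ := fun t => D (γ t) - Complex.log (1 - r / d * e t) + t * Complex.I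
  have hN : Continuous N := by
    refine (Continuous.sub ?_ ?_).add (by fun_prop)
    · rw [continuous_iff_continuousAt]
      intro t
      exact ContinuousAt.comp (f := γ) (g := D) (hcont _ (hγ t)).1
        (by fun_prop : Continuous γ).continuousAt
    · exact Continuous.clog (by fun_prop) hslit
  have hNexp : ∀ t, Complex.exp (N t) = -d / r := by
    intro t
    have h1 := Complex.slitPlane_ne_zero (hslit t)
    simp only [N]
    rw [Complex.exp_add, Complex.exp_sub, (hcont _ (hγ t)).2, Complex.exp_log h1]
    change (f y - (f x + r * e t)) / (f x - (f x + r * e t)) / _ * e t = _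
    have h2 : f y - (f x + r * e t) = d * (1 - r / d * e t) := by
      field_simp
      rw [hd]; ring
    have h3 := he0 t
    rw [h2, sub_add_cancel_left]
    generalize 1 - r / d * e t = w at h1
    field_simp
  have h := sub_eq_sub_of_exp_eq (K := ℝ) isPreconnected_univ hN.continuousOn
    (L' := fun _ => N 0) continuousOn_const (fun s _ => by rw [hNexp, hNexp])
    (mem_univ 0) (mem_univ (2 * Real.pi))
  have he2 : e (2 * Real.pi) = e 0 := by
    simp [e, Complex.exp_two_pi_mul_I]
  have hγ2 : γ (2 * Real.pi) = γ 0 := by simp only [γ, he2]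
  simp only [N, hγ2, he2] at h
  have : (2 * Real.pi : ℂ) * Complex.I = 0 := by
    push_cast at h
    linear_combination h
  exact Complex.two_pi_I_ne_zero this

/-- `P` and `Q` are approximately separated by almost `[0, 1]`-valued functions in `B`. -/
def ApproxSeparated (B : Subalgebra ℂ C(K, ℂ)) (P Q : Set K) : Prop :=
  ∀ ε > 0, ∃ F ∈ B, (∀ p, ∃ t : ℝ, 0 ≤ t ∧ t ≤ 1 ∧ ‖F p - t‖ ≤ ε) ∧
    (∀ p ∈ P, ‖F p - 1‖ ≤ ε) ∧ ∀ p ∈ Q, ‖F p‖ ≤ ε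

namespace ApproxSeparated

variable {B : Subalgebra ℂ C(K, ℂ)} {P P' Q Q' : Set K}

theorem mono (h : ApproxSeparated B P Q) (hP : P' ⊆ P) (hQ : Q' ⊆ Q) :
    ApproxSeparated B P' Q' := by
  intro ε hε
  obtain ⟨F, hF, ht, h1, h0⟩ := h ε hε
  exact ⟨F, hF, ht, fun p hp => h1 p (hP hp), fun p hp => h0 p (hQ hp)⟩

theorem symm (h : ApproxSeparated B P Q) : ApproxSeparated B Q P := by
  intro ε hε
  obtain ⟨F, hF, ht, h1, h0⟩ := h ε hε
  refine ⟨1 - F, sub_mem (one_mem B) hF, fun p => ?_, fun p hp => ?_, fun p hp => ?_⟩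
  · obtain ⟨t, ht0, ht1, hFt⟩ := ht p
    refine ⟨1 - t, by linarith, by linarith, ?_⟩
    have : (1 - F) p - ((1 - t : ℝ) : ℂ) = -(F p - t) := by
      simp only [ContinuousMap.sub_apply, ContinuousMap.one_apply]
      push_cast
      ring
    rwa [this, norm_neg]
  · simpa using h0 p hp
  · rw [← norm_neg]
    simpa using h1 p hp

theorem empty_right : ApproxSeparated B P ∅ := fun ε hε =>
  ⟨1, one_mem B, fun _ => ⟨1, by simp, by simp, by simp [hε.le]⟩, by simp [hε.le], by simp⟩

theorem union_right (h : ApproxSeparated B P Q) (h' : ApproxSeparated B P Q') :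
    ApproxSeparated B P (Q ∪ Q') := by
  intro ε hε
  have he : 0 < min (ε / 3) 1 := by positivity
  obtain ⟨F, hF, ht, h1, h0⟩ := h _ he
  obtain ⟨G, hG, ht', h1', h0'⟩ := h' _ he
  set e := min (ε / 3) 1 with hedef
  have he1 : e ≤ 1 := min_le_right _ _
  have he3 : 3 * e ≤ ε := by
    have := min_le_left (ε / 3) 1
    linarith
  have hbound : ∀ {F : C(K, ℂ)}, (∀ p, ∃ t : ℝ, 0 ≤ t ∧ t ≤ 1 ∧ ‖F p - t‖ ≤ e) →
      ∀ p, ‖F p‖ ≤ 2 := by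
    intro F ht p
    obtain ⟨t, ht0, ht1, hFt⟩ := ht p
    have := norm_le_norm_sub_add (F p) t
    rw [Complex.norm_real, Real.norm_of_nonneg ht0] at this
    linarith
  have hF2 := hbound ht
  have hG2 := hbound ht'
  have hest : ∀ p (t s : ℂ), ‖s‖ ≤ 1 → ‖F p - t‖ ≤ e → ‖G p - s‖ ≤ e →
      ‖F p * G p - t * s‖ ≤ ε := by
    intro p t s hs h1 h2
    have : F p * G p - t * s = F p * (G p - s) + (F p - t) * s := by ring
    rw [this]
    refine (norm_add_le _ _).trans ?_
    rw [norm_mul, norm_mul]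
    have h3 := mul_le_mul (hF2 p) h2 (norm_nonneg _) zero_le_two
    have h4 := mul_le_mul h1 hs (norm_nonneg _) he.le
    linarith
  refine ⟨F * G, mul_mem hF hG, fun p => ?_, fun p hp => ?_, ?_⟩
  · obtain ⟨t, ht0, ht1, hFt⟩ := ht p
    obtain ⟨s, hs0, hs1, hGs⟩ := ht' p
    refine ⟨t * s, mul_nonneg ht0 hs0, mul_le_one₀ ht1 hs0 hs1, ?_⟩
    push_cast
    refine hest p t s ?_ hFt hGs
    rwa [Complex.norm_real, Real.norm_of_nonneg hs0]
  · simpa using hest p 1 1 (by simp) (h1 p hp) (h1' p hp)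
  · rintro p (hp | hp)
    · have h3 := mul_le_mul (h0 p hp) (hG2 p) (norm_nonneg _) he.le
      rw [ContinuousMap.mul_apply, norm_mul]
      linarith
    · have h3 := mul_le_mul (hF2 p) (h0' p hp) (norm_nonneg _) zero_le_two
      rw [ContinuousMap.mul_apply, norm_mul]
      linarith

theorem of_isCompact (hP : IsCompact P) (hQ : IsCompact Q)
    (h : ∀ x ∈ P, ∀ y ∈ Q, ∃ V ∈ 𝓝 x, ∃ V' ∈ 𝓝 y, ApproxSeparated B V V') :
    ApproxSeparated B P Q := by
  have hx : ∀ x ∈ P, ∃ V ∈ 𝓝 x, ApproxSeparated B V Q := by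
    intro x hx
    refine hQ.induction_on (p := fun Q => ∃ V ∈ 𝓝 x, ApproxSeparated B V Q)
      ⟨univ, univ_mem, empty_right⟩ ?_ ?_ ?_
    · rintro s t hst ⟨V, hV, hVt⟩
      exact ⟨V, hV, hVt.mono subset_rfl hst⟩
    · rintro s t ⟨V, hV, hVs⟩ ⟨W, hW, hWt⟩
      exact ⟨V ∩ W, inter_mem hV hW, (hVs.mono inter_subset_left subset_rfl).union_right
        (hWt.mono inter_subset_right subset_rfl)⟩
    · intro y hy
      obtain ⟨V, hV, V', hV', hs⟩ := h x hx y hy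
      exact ⟨V', mem_nhdsWithin_of_mem_nhds hV', V, hV, hs⟩
  refine hP.induction_on (p := fun P => ApproxSeparated B P Q) empty_right.symm
    (fun s t hst ht => ht.mono hst subset_rfl)
    (fun s t hs ht => (hs.symm.union_right ht.symm).symm) ?_
  intro x hxP
  obtain ⟨V, hV, hs⟩ := hx x hxP
  exact ⟨V, mem_nhdsWithin_of_mem_nhds hV, hs⟩

end ApproxSeparated

theorem exists_nhds_approxSeparated [CompactSpace K] [LocallyConnectedSpace K]
    {B : Subalgebra ℂ C(K, ℂ)}
    (hB : ∀ q g : C(K, ℂ), g ∈ B → ∀ k, 0 < k → q ^ (k + k) = g * q ^ k → q ∈ B)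
    {f : C(K, ℂ)} (hfB : f ∈ B) (hf : ∀ c : ℂ, ExpApprox fun p => f p - c) {x y : K}
    (hxy : f x ≠ f y) : ∃ V ∈ 𝓝 x, ∃ V' ∈ 𝓝 y, ApproxSeparated B V V' := by
  classical
  have hd : 0 < ‖f y - f x‖ := norm_pos_iff.2 (sub_ne_zero.2 hxy.symm)
  set d := ‖f y - f x‖ with hddef
  have hball : ∀ z, ∃ V ∈ 𝓝 z, IsPreconnected V ∧ ∀ s ∈ V, ‖f s - f z‖ < d / 8 := by
    intro z
    have : {s | ‖f s - f z‖ < d / 8} ∈ 𝓝 z :=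
      (isOpen_lt (by fun_prop) continuous_const).mem_nhds (by simpa using hd)
    obtain ⟨V, hVU, hVo, hV, hzV⟩ := exists_isPreconnected_nhds this
    exact ⟨V, hVo.mem_nhds hzV, hV, hVU⟩
  obtain ⟨V, hVx, hV, hVd⟩ := hball x
  obtain ⟨V', hVy, hV', hVd'⟩ := hball y
  refine ⟨V, hVx, V', hVy, fun ε hε => ?_⟩
  obtain ⟨M, hM⟩ := exists_nat_gt (4 / ε)
  have hM0 : (0 : ℝ) < M := (by positivity : 0 < 4 / ε).trans hM
  have hM1 : (1 : ℝ) ≤ M := by exact_mod_cast Nat.cast_pos.1 hM0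
  have hMc : (M : ℂ) ≠ 0 := by exact_mod_cast hM0.ne'
  have hMε : 4 / M ≤ ε := by
    rw [div_lt_iff₀ hε] at hM
    rw [div_le_iff₀ hM0]
    linarith
  let δ := d / (8 * M)
  have hδ : 0 < δ := by positivity
  have hδM : δ * M = d / 8 := by
    simp only [δ]
    field_simp
  have hδd : δ ≤ d / 8 := by nlinarith
  let r : Fin M → ℝ := fun j => d / 4 + 2 * δ * j
  have hr : ∀ j, d / 4 ≤ r j ∧ r j ≤ d / 2 := by
    intro j
    have h1 : (j : ℝ) ≤ M := by exact_mod_cast j.2.le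
    have h2 := mul_le_mul_of_nonneg_left h1 hδ.le
    have h3 : 0 ≤ δ * (j : ℝ) := by positivity
    simp only [r]
    constructor <;> nlinarith
  have hc : ∀ j, ∃ c : ℂ, ‖c - f x‖ = r j ∧ ¬ JoinedOff (fun p => f p - c) x y := fun j =>
    exists_not_joinedOff_sub f.continuous hf (by linarith [(hr j).1]) (by linarith [(hr j).2])
  choose c hcr hcj using hc
  have hcsep : ∀ i j, i ≠ j → 2 * δ ≤ ‖c i - c j‖ := by
    intro i j hij
    have h1 : |r i - r j| ≤ ‖c i - c j‖ := by
      rw [← hcr, ← hcr]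
      refine (abs_norm_sub_norm_le _ _).trans_eq ?_
      simp
    refine le_trans ?_ h1
    have h2 : r i - r j = 2 * δ * (((i : ℤ) - (j : ℤ) : ℤ) : ℝ) := by
      simp only [r]
      push_cast
      ring
    have h3 : (1 : ℝ) ≤ |(((i : ℤ) - (j : ℤ) : ℤ) : ℝ)| := by
      have : (i : ℤ) - (j : ℤ) ≠ 0 := by
        rw [sub_ne_zero]
        exact_mod_cast fun h => hij (Fin.ext h)
      exact_mod_cast Int.one_le_abs this
    rw [h2, abs_mul, abs_of_pos (by positivity : 0 < 2 * δ)]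
    nlinarith
  have hxc : ∀ j, ∀ s ∈ V, d / 8 ≤ ‖f s - c j‖ := by
    intro j s hs
    have h1 := norm_sub_norm_le (c j - f x) (f s - f x)
    have h2 := hVd s hs
    rw [hcr, sub_sub_sub_cancel_right, norm_sub_rev (c j)] at h1
    linarith [(hr j).1]
  have hyc : ∀ j, ∀ s ∈ V', d / 8 ≤ ‖f s - c j‖ := by
    intro j s hs
    have h1 := norm_sub_le (f s - c j) (f s - f y)
    have h2 := hVd' s hs
    have h3 := norm_sub_le (f y - c j) (f x - c j)
    rw [sub_sub_sub_cancel_left] at h1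
    rw [sub_sub_sub_cancel_right, norm_sub_rev (f x), hcr] at h3
    linarith [(hr j).2]
  have hq := fun j => exists_root_near_indicator (g := fun p => f p - c j) (by fun_prop) (hf (c j))
    x (η := 1 / M) (by positivity) hδ
  choose q k hk hqk hq0 hq2 hq1 using hq
  have hqB : ∀ j, q j ∈ B := by
    intro j
    refine hB (q j) ((f x - c j)⁻¹ • (f - algebraMap ℂ C(K, ℂ) (c j)))
      (B.smul_mem (sub_mem hfB (B.algebraMap_mem _)) _) (k j) (hk j) ?_
    ext p
    by_cases hp : JoinedOff (fun p => f p - c j) x p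
    · simp [pow_add, hqk j p hp]
      ring
    · simp [hq0 j p hp, (hk j).ne']
  have hsum : ∀ p (g : Fin M → ℂ) (E : ℝ), ∑ j, ‖q j p - g j‖ ≤ E →
      ‖((M : ℂ)⁻¹ • ∑ j, q j : C(K, ℂ)) p - (M : ℂ)⁻¹ * ∑ j, g j‖ ≤ E / M := by
    intro p g E hE
    have : ((M : ℂ)⁻¹ • ∑ j, q j : C(K, ℂ)) p - (M : ℂ)⁻¹ * ∑ j, g j
        = (M : ℂ)⁻¹ * ∑ j, (q j p - g j) := by
      simp [Finset.sum_sub_distrib, mul_sub]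
    rw [this, norm_mul, norm_inv, Complex.norm_natCast, inv_mul_eq_div]
    gcongr
    exact (norm_sum_le _ _).trans hE
  refine ⟨(M : ℂ)⁻¹ • ∑ j, q j, B.smul_mem (sum_mem fun j _ => hqB j) _, fun p => ?_,
    fun p hp => ?_, fun p hp => ?_⟩
  · let χ : Fin M → ℝ := fun j => if JoinedOff (fun p => f p - c j) x p then 1 else 0
    have hχ0 : ∀ j, 0 ≤ χ j := fun j => by simp only [χ]; split_ifs <;> norm_num
    have hχ1 : ∀ j, χ j ≤ 1 := fun j => by simp only [χ]; split_ifs <;> norm_num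
    have hterm : ∀ j, ‖q j p - χ j‖ ≤ 1 / M + if ‖f p - c j‖ < δ then 3 else 0 := by
      intro j
      have hM' : (0 : ℝ) ≤ 1 / M := by positivity
      by_cases hp : JoinedOff (fun p => f p - c j) x p
      · simp only [χ, if_pos hp]
        split_ifs with h
        · have h1 := norm_sub_le (q j p) ((1 : ℝ) : ℂ)
          have h2 := hq2 j p
          rw [Complex.norm_real, norm_one] at h1
          linarith
        · have := hq1 j p hp (not_lt.1 h)
          simpa using this
      · simp only [χ, if_neg hp, hq0 j p hp]
        simp only [Complex.ofReal_zero, sub_zero, norm_zero]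
        split_ifs <;> linarith
    have hcard : (Finset.univ.filter fun j => ‖f p - c j‖ < δ).card ≤ 1 := by
      rw [Finset.card_le_one]
      intro i hi j hj
      by_contra hij
      simp only [Finset.mem_filter, Finset.mem_univ, true_and] at hi hj
      have h1 := norm_sub_le (f p - c j) (f p - c i)
      rw [sub_sub_sub_cancel_left] at h1
      linarith [hcsep i j hij]
    have hE : ∑ j, ‖q j p - χ j‖ ≤ 4 := by
      refine (Finset.sum_le_sum fun j _ => hterm j).trans ?_
      rw [Finset.sum_add_distrib, ← Finset.sum_filter]
      simp only [Finset.sum_const, Finset.card_univ, Fintype.card_fin, nsmul_eq_mul]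
      rw [mul_one_div_cancel hM0.ne']
      have : ((Finset.univ.filter fun j => ‖f p - c j‖ < δ).card : ℝ) ≤ 1 := by exact_mod_cast hcard
      linarith
    refine ⟨(M : ℝ)⁻¹ * ∑ j, χ j, ?_, ?_, ?_⟩
    · exact mul_nonneg (by positivity) (Finset.sum_nonneg fun j _ => hχ0 j)
    · rw [inv_mul_le_iff₀ hM0, mul_one]
      refine (Finset.sum_le_sum fun j _ => hχ1 j).trans ?_
      simp
    · push_cast
      exact (hsum p (fun j => χ j) 4 hE).trans hMε
  · have hj : ∀ j, JoinedOff (fun p => f p - c j) x p := fun j =>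
      ⟨V, hV, mem_of_mem_nhds hVx, hp, d / 8, by positivity, hxc j⟩
    have hE : ∑ j, ‖q j p - 1‖ ≤ 4 := by
      refine (Finset.sum_le_sum fun j _ => hq1 j p (hj j) (hδd.trans (hxc j p hp))).trans ?_
      simp only [Finset.sum_const, Finset.card_univ, Fintype.card_fin, nsmul_eq_mul]
      rw [mul_one_div_cancel hM0.ne']
      norm_num
    have := (hsum p (fun _ => 1) 4 hE).trans hMε
    simpa [hMc] using this
  · have hj : ∀ j, ¬ JoinedOff (fun p => f p - c j) x p := fun j h => hcj j <|
      h.trans ⟨V', hV', hp, mem_of_mem_nhds hVy, d / 8, by positivity, hyc j⟩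
    simp [hq0 _ p (hj _), hε.le]

/-- If elements of `B` are uniform limits of nowhere-vanishing functions and `B` approximately
separates disjoint closed sets, then every open cover by three sets has an open shrinking with
empty total intersection. -/
theorem exists_shrinking_three [CompactSpace K] [T2Space K] {B : Subalgebra ℂ C(K, ℂ)}
    (hB : ∀ f ∈ B, ∀ ε > 0, ∃ F : C(K, ℂ), (∀ x, F x ≠ 0) ∧ ∀ x, ‖F x - f x‖ < ε)
    (hsep : ∀ P Q : Set K, IsClosed P → IsClosed Q → Disjoint P Q → ApproxSeparated B P Q)
    (U : Fin 3 → Set K) (hU : ∀ i, IsOpen (U i)) (hcov : ⋃ i, U i = univ) :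
    ∃ W : Fin 3 → Set K, (∀ i, IsOpen (W i)) ∧ ⋃ i, W i = univ ∧ (∀ i, W i ⊆ U i) ∧
      ∀ x, ∃ i, x ∉ W i := by
  obtain ⟨P, hPcov, hPcl, hPU⟩ := exists_iUnion_eq_closed_subset hU (fun _ => toFinite _) hcov
  have hF := fun i => hsep (P i) (U i)ᶜ (hPcl i) (hU i).isClosed_compl
    (disjoint_compl_right_iff_subset.2 (hPU i)) (1 / 256) (by norm_num)
  choose F hFB hFt hF1 hF0 using hF
  let φ : Fin 3 → C(K, ℝ) := fun i => ⟨fun p => max 0 ((F i p).re - 1 / 256), by fun_prop⟩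
  have hφ0 : ∀ i p, 0 ≤ φ i p := fun i p => le_max_left _ _
  have hφ1 : ∀ i, ∀ p ∈ P i, 1 / 2 ≤ φ i p := by
    intro i p hp
    refine le_trans ?_ (le_max_right _ _)
    have h1 := (Complex.abs_re_le_norm _).trans (hF1 i p hp)
    rw [abs_le, Complex.sub_re, Complex.one_re] at h1
    linarith
  have hφU : ∀ i p, p ∉ U i → φ i p = 0 := by
    intro i p hp
    have h1 := (Complex.re_le_norm _).trans (hF0 i p hp)
    exact max_eq_left (by linarith)
  have hφF : ∀ i p, ‖F i p - φ i p‖ ≤ 3 / 256 := by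
    intro i p
    obtain ⟨t, ht0, ht1, ht⟩ := hFt i p
    have h1 := (Complex.abs_re_le_norm _).trans ht
    rw [abs_le, Complex.sub_re, Complex.ofReal_re] at h1
    have h2 : |t - φ i p| ≤ 2 / 256 := by
      change |t - max 0 _| ≤ _
      rw [abs_le]
      constructor
      · have : max 0 ((F i p).re - 1 / 256) ≤ t := max_le ht0 (by linarith)
        linarith
      · have := le_max_right 0 ((F i p).re - 1 / 256)
        linarith
    have h3 := norm_sub_le_norm_sub_add_norm_sub (F i p) t (φ i p)
    rw [← Complex.ofReal_sub, Complex.norm_real, Real.norm_eq_abs] at h3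
    linarith
  let G : K → ℂ := fun p => (φ 1 p - φ 0 p : ℝ) + (φ 2 p - φ 0 p : ℝ) * Complex.I
  have hG : Continuous G := by fun_prop
  have hGre : ∀ p, (G p).re = φ 1 p - φ 0 p := fun p => by simp [G]
  have hGim : ∀ p, (G p).im = φ 2 p - φ 0 p := fun p => by simp [G]
  have hGbig : ∀ p i, φ i p = 0 → 1 / 8 ≤ ‖G p‖ := by
    intro p i hi
    have hp : p ∈ ⋃ i, P i := hPcov ▸ mem_univ p
    obtain ⟨j, hj⟩ := mem_iUnion.1 hp
    have h1 := hφ1 j p hj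
    have h2 := Complex.abs_re_le_norm (G p)
    have h3 := Complex.abs_im_le_norm (G p)
    rw [hGre, abs_le] at h2
    rw [hGim, abs_le] at h3
    fin_cases i <;> fin_cases j <;> simp only [Fin.mk_zero, Fin.mk_one, Fin.reduceFinMk,
      Fin.isValue] at hi h1 <;> linarith
  obtain ⟨H, hH0, hH⟩ := hB ((F 1 - F 0) + Complex.I • (F 2 - F 0))
    (add_mem (sub_mem (hFB 1) (hFB 0)) (B.smul_mem (sub_mem (hFB 2) (hFB 0)) _))
    (1 / 256) (by norm_num)
  have hHG : ∀ p, ‖H p - G p‖ < 1 / 16 := by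
    intro p
    have h1 : H p - G p = (H p - ((F 1 - F 0) + Complex.I • (F 2 - F 0) : C(K, ℂ)) p)
        + (((F 1 p - φ 1 p) - (F 0 p - φ 0 p))
          + Complex.I * ((F 2 p - φ 2 p) - (F 0 p - φ 0 p))) := by
      simp [G]
      ring
    rw [h1]
    have h2 := hH p
    have h3 := norm_sub_le (F 1 p - φ 1 p) (F 0 p - φ 0 p)
    have h4 := norm_sub_le (F 2 p - φ 2 p) (F 0 p - φ 0 p)
    have h5 := norm_add_le (((F 1 p : ℂ) - φ 1 p) - (F 0 p - φ 0 p))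
      (Complex.I * ((F 2 p - φ 2 p) - (F 0 p - φ 0 p)))
    rw [norm_mul, Complex.norm_I, one_mul] at h5
    refine (norm_add_le _ _).trans_lt ?_
    linarith [hφF 0 p, hφF 1 p, hφF 2 p]
  let t : K → ℝ := fun p => max 0 (min 1 (2 - 16 * ‖G p‖))
  have ht : Continuous t := by fun_prop
  let E : K → ℂ := fun p => G p + t p * (H p - G p)
  have hE : Continuous E := by fun_prop
  have hE0 : ∀ p, E p ≠ 0 := by
    intro p
    rcases le_or_gt ‖G p‖ (1 / 16) with h | h
    · have : t p = 1 := by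
        simp only [t]
        rw [min_eq_left (by linarith), max_eq_right zero_le_one]
      simp only [E, this]
      simpa using hH0 p
    · intro h0
      have h1 : G p = -(t p * (H p - G p)) := eq_neg_of_add_eq_zero_left h0
      have h2 : ‖G p‖ ≤ ‖H p - G p‖ := by
        conv_lhs => rw [h1]
        rw [norm_neg, norm_mul, Complex.norm_real, Real.norm_of_nonneg (le_max_left _ _)]
        exact mul_le_of_le_one_left (norm_nonneg _)
          (max_le zero_le_one (min_le_left _ _))
      linarith [hHG p]
  have hEG : ∀ p, 1 / 8 ≤ ‖G p‖ → E p = G p := by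
    intro p hp
    have : t p = 0 := by
      simp only [t]
      exact max_eq_left ((min_le_right _ _).trans (by linarith))
    simp [E, this]
  let s : Fin 3 → K → ℝ := ![fun _ => 0, fun p => (E p).re, fun p => (E p).im]
  have hs : ∀ i, Continuous (s i) := by
    intro i
    fin_cases i
    · exact continuous_const
    · exact Complex.continuous_re.comp hE
    · exact Complex.continuous_im.comp hE
  refine ⟨fun i => {p | ∃ j, s j p < s i p}, fun i => ?_, ?_, fun i p hp => ?_, fun p => ?_⟩
  · simp only [ofPred_exists]
    exact isOpen_iUnion fun j => isOpen_lt (hs j) (hs i)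
  · rw [eq_univ_iff_forall]
    intro p
    by_contra hp
    simp only [mem_iUnion, mem_ofPred_eq, not_exists, not_lt] at hp
    apply hE0 p
    apply Complex.ext
    · exact le_antisymm (hp 1 0) (hp 0 1)
    · exact le_antisymm (hp 2 0) (hp 0 2)
  · by_contra hpU
    have h0 := hφU i p hpU
    have hEp := hEG p (hGbig p i h0)
    have hsφ : ∀ j, s j p = φ j p - φ 0 p := by
      intro j
      fin_cases j
      · simp [s]
      · simp [s, hEp, hGre]
      · simp [s, hEp, hGim]
    obtain ⟨j, hj⟩ := hp
    rw [hsφ, hsφ, h0] at hj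
    linarith [hφ0 j p]
  · obtain ⟨i, hi⟩ := Finite.exists_min fun i => s i p
    exact ⟨i, fun ⟨j, hj⟩ => absurd hj (not_lt.2 (hi j))⟩

/-- Shrinking property for triples implies covering dimension at most one. -/
theorem coveringDimLE_one_of_shrinking_three [CompactSpace K]
    (h : ∀ U : Fin 3 → Set K, (∀ i, IsOpen (U i)) → ⋃ i, U i = univ →
      ∃ W : Fin 3 → Set K, (∀ i, IsOpen (W i)) ∧ ⋃ i, W i = univ ∧ (∀ i, W i ⊆ U i) ∧
        ∀ x, ∃ i, x ∉ W i) : CoveringDimLE K 1 := by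
  classical
  intro ι U hU hcov
  obtain ⟨s, hs⟩ := isCompact_univ.elim_finite_subcover U hU hcov.ge
  have key : ∀ T : Finset (ι × ι × ι), ∃ V : ι → Set K, (∀ i, IsOpen (V i)) ∧
      ⋃ i, V i = univ ∧ (∀ i, V i ⊆ if i ∈ s then U i else ∅) ∧
      ∀ i j k, (i, j, k) ∈ T → i ≠ j → i ≠ k → j ≠ k → ∀ x, ¬ (x ∈ V i ∧ x ∈ V j ∧ x ∈ V k) := by
    intro T
    induction T using Finset.induction_on with
    | empty =>
      refine ⟨fun i => if i ∈ s then U i else ∅, fun i => ?_, ?_, fun i => subset_rfl, by simp⟩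
      · dsimp only
        split_ifs
        exacts [hU i, isOpen_empty]
      · rw [eq_univ_iff_forall]
        intro x
        obtain ⟨i, hi, hx⟩ := mem_iUnion₂.1 (hs (mem_univ x))
        exact mem_iUnion.2 ⟨i, by simpa [hi] using hx⟩
    | insert a T ha ih =>
      obtain ⟨V, hVo, hVcov, hVU, hVT⟩ := ih
      obtain ⟨a₁, a₂, a₃⟩ := a
      by_cases h12 : a₁ = a₂
      · refine ⟨V, hVo, hVcov, hVU, fun i j k hijk hij => ?_⟩
        refine hVT i j k ((Finset.mem_insert.1 hijk).resolve_left fun he => hij ?_) hij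
        simp only [Prod.mk.injEq] at he
        rw [he.1, he.2.1, h12]
      obtain ⟨W, hWo, hWcov, hWU, hW⟩ := h
        ![V a₁, V a₂, ⋃ l : {l // l ≠ a₁ ∧ l ≠ a₂}, V l] (by
          intro i
          fin_cases i
          exacts [hVo _, hVo _, isOpen_iUnion fun l => hVo l]) (by
          rw [eq_univ_iff_forall]
          intro x
          obtain ⟨l, hl⟩ := mem_iUnion.1 (hVcov.ge (mem_univ x))
          rw [mem_iUnion]
          by_cases h1 : l = a₁
          · exact ⟨0, h1 ▸ hl⟩
          by_cases h2 : l = a₂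
          · exact ⟨1, h2 ▸ hl⟩
          exact ⟨2, mem_iUnion.2 ⟨⟨l, h1, h2⟩, hl⟩⟩)
      let V' : ι → Set K := fun l => if l = a₁ then W 0 else if l = a₂ then W 1 else W 2 ∩ V l
      have hV'V : ∀ l, V' l ⊆ V l := by
        intro l
        simp only [V']
        split_ifs with h1 h2
        · exact h1 ▸ hWU 0
        · exact h2 ▸ hWU 1
        · exact inter_subset_right
      refine ⟨V', fun l => ?_, ?_, fun l => (hV'V l).trans (hVU l), ?_⟩
      · simp only [V']
        split_ifs
        exacts [hWo 0, hWo 1, (hWo 2).inter (hVo l)]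
      · rw [eq_univ_iff_forall]
        intro x
        obtain ⟨i, hi⟩ := mem_iUnion.1 (hWcov.ge (mem_univ x))
        rw [mem_iUnion]
        fin_cases i
        · exact ⟨a₁, by simpa [V'] using hi⟩
        · exact ⟨a₂, by simpa [V', Ne.symm h12] using hi⟩
        · obtain ⟨⟨l, h1, h2⟩, hl⟩ := mem_iUnion.1 (hWU 2 hi)
          exact ⟨l, by simpa [V', h1, h2] using ⟨hi, hl⟩⟩
      · intro i j k hijk hij hik hjk x hx
        rcases Finset.mem_insert.1 hijk with he | he
        · simp only [Prod.mk.injEq] at he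
          obtain ⟨rfl, rfl, rfl⟩ := he
          obtain ⟨m, hm⟩ := hW x
          simp only [V', if_pos, if_neg hij.symm, if_neg hik.symm, if_neg hjk.symm] at hx
          fin_cases m
          exacts [hm hx.1, hm hx.2.1, hm hx.2.2.1]
        · exact hVT i j k he hij hik hjk x ⟨hV'V i hx.1, hV'V j hx.2.1, hV'V k hx.2.2⟩
  obtain ⟨V, hVo, hVcov, hVU, hVT⟩ := key (s ×ˢ s ×ˢ s)
  have hVs : ∀ i x, x ∈ V i → i ∈ s := by
    intro i x hx
    by_contra hi
    simpa [hi] using hVU i hx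
  refine ⟨V, hVo, hVcov, fun i x hx => by simpa [hVs i x hx] using hVU i hx, fun x => ?_⟩
  have hfin : {i | x ∈ V i}.Finite := s.finite_toSet.subset fun i hi => hVs i x hi
  refine ⟨hfin, ?_⟩
  by_contra! hlt
  obtain ⟨i, j, k, hi, hj, hk, hij, hik, hjk⟩ := (two_lt_ncard_iff hfin).1 hlt
  exact hVT i j k (by simp [hVs i x hi, hVs j x hj, hVs k x hk]) hij hik hjk x ⟨hi, hj, hk⟩

theorem IsIntegral.of_pow_add_eq_mul_pow {R S : Type*} [CommRing R] [CommRing S] [Algebra R S]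
    {g q : S} (hg : IsIntegral R g) {k : ℕ} (hk : 0 < k) (hq : q ^ (k + k) = g * q ^ k) :
    IsIntegral R q := by
  refine IsIntegral.of_pow hk ?_
  refine isIntegral_trans (A := integralClosure R S) (q ^ k) ?_
  refine ⟨Polynomial.X ^ 2 - Polynomial.C ⟨g, hg⟩ * Polynomial.X, ?_, ?_⟩
  · monicity!
  · rw [pow_add] at hq
    simp only [Polynomial.eval₂_sub, Polynomial.eval₂_pow, Polynomial.eval₂_X,
      Polynomial.eval₂_mul, Polynomial.eval₂_C]
    rw [sq, hq]
    exact sub_self _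

/-- A uniform algebra with dense units on a compact, locally connected space with trivial first
Čech cohomology forces the space to have covering dimension at most one. -/
theorem coveringDimLE_one_of_dense_isUnit [CompactSpace K] [T2Space K] [LocallyConnectedSpace K]
    (hH1 : FirstCechH1Trivial K) (A : Subalgebra ℂ C(K, ℂ)) [CompleteSpace A]
    (hA : Dense {a : A | IsUnit a}) (hsep : ∀ x y : K, x ≠ y → ∃ f ∈ A, f x ≠ f y) :
    CoveringDimLE K 1 := by
  let B : Subalgebra ℂ C(K, ℂ) := (integralClosure A C(K, ℂ)).restrictScalars ℂ
  have hmem : ∀ f, f ∈ B ↔ IsIntegral A f := fun f => Iff.rfl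
  have hAB : ∀ f ∈ A, f ∈ B := fun f hf => (hmem f).2 (isIntegral_algebraMap (x := (⟨f, hf⟩ : A)))
  have hB : ∀ f ∈ B, ∀ ε > 0, ∃ F : C(K, ℂ), (∀ x, F x ≠ 0) ∧ ∀ x, ‖F x - f x‖ < ε :=
    fun f hf ε hε => exists_ne_zero_near_of_isIntegral A hA f ((hmem f).1 hf) ε hε
  have hroot : ∀ q g, g ∈ B → ∀ k, 0 < k → q ^ (k + k) = g * q ^ k → q ∈ B :=
    fun q g hg k hk hq => (hmem q).2 (((hmem g).1 hg).of_pow_add_eq_mul_pow hk hq)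
  have hexp : ∀ f ∈ A, ∀ c : ℂ, ExpApprox fun p => f p - c := by
    intro f hf c ε hε
    obtain ⟨F, hF0, hF⟩ := hB (f - algebraMap ℂ C(K, ℂ) c)
      (sub_mem (hAB f hf) (B.algebraMap_mem c)) ε hε
    obtain ⟨h, hh⟩ := hH1 F hF0
    exact ⟨h, fun x => by simpa [← hh x] using hF x⟩
  refine coveringDimLE_one_of_shrinking_three (exists_shrinking_three hB fun P Q hP hQ hPQ => ?_)
  refine ApproxSeparated.of_isCompact hP.isCompact hQ.isCompact fun x hx y hy => ?_
  obtain ⟨f, hf, hxy⟩ := hsep x y (hPQ.ne_of_mem hx hy)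
  exact exists_nhds_approxSeparated hroot (hAB f hf) (hexp f hf) hxy

/-- Sup-norm estimates for polynomials on `X` persist on the polynomial hull. -/
theorem norm_eval_le_of_mem_polyHull {N : ℕ} {X : Set (Fin N → ℂ)} {z : Fin N → ℂ}
    (hz : z ∈ polyHull X) {p : MvPolynomial (Fin N) ℂ} {c : ℝ} (hc : 0 ≤ c)
    (h : ∀ x ∈ X, ‖MvPolynomial.eval x p‖ ≤ c) : ‖MvPolynomial.eval z p‖ ≤ c := by
  refine (hz p).trans (Real.sSup_le ?_ hc)
  rintro _ ⟨x, hx, rfl⟩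
  exact h x hx

/-- If `P(X)` has dense units, every polynomial is close on `X` to a polynomial having an
approximate polynomial inverse on `X`. -/
theorem exists_approx_inverse {N : ℕ} {X : Set (Fin N → ℂ)} (hX : IsCompact X)
    (hd : polyAlg X ⊆ closure {g : C(↥X, ℂ) | g ∈ polyAlg X ∧ ∃ h ∈ polyAlg X, g * h = 1})
    (p₀ : MvPolynomial (Fin N) ℂ) {ε : ℝ} (hε : 0 < ε) :
    ∃ p q : MvPolynomial (Fin N) ℂ, (∀ x ∈ X, ‖MvPolynomial.eval x (p - p₀)‖ ≤ ε) ∧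
      ∀ x ∈ X, ‖MvPolynomial.eval x (1 - p * q)‖ ≤ 1 / 2 := by
  have : CompactSpace X := isCompact_iff_compactSpace.1 hX
  let f₀ : C(X, ℂ) := ⟨fun x => MvPolynomial.eval (x : Fin N → ℂ) p₀,
    (MvPolynomial.continuous_eval p₀).comp continuous_subtype_val⟩
  obtain ⟨g, ⟨hg, h, hh, hgh⟩, hgf⟩ := Metric.mem_closure_iff.1
    (hd (subset_closure ⟨p₀, fun x => rfl⟩ : f₀ ∈ polyAlg X)) ε hε
  let S : Set (C(X, ℂ) × C(X, ℂ)) := {w | dist f₀ w.1 < ε ∧ dist 1 (w.1 * w.2) < 1 / 2}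
  have hS : IsOpen S := by
    refine IsOpen.and (isOpen_lt ?_ continuous_const) (isOpen_lt ?_ continuous_const) <;> fun_prop
  have hmem : (g, h) ∈ S := ⟨hgf, by simp [hgh]⟩
  have hcl : (g, h) ∈ closure ({f : C(↥X, ℂ) | ∃ p : MvPolynomial (Fin N) ℂ,
      ∀ x : X, f x = MvPolynomial.eval (x : Fin N → ℂ) p} ×ˢ {f : C(↥X, ℂ) |
      ∃ p : MvPolynomial (Fin N) ℂ, ∀ x : X, f x = MvPolynomial.eval (x : Fin N → ℂ) p}) := by
    rw [closure_prod_eq]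
    exact ⟨hg, hh⟩
  obtain ⟨⟨u, v⟩, ⟨hu, huv⟩, ⟨p, hp⟩, ⟨q, hq⟩⟩ := mem_closure_iff.1 hcl S hS hmem
  refine ⟨p, q, fun x hx => ?_, fun x hx => ?_⟩
  · have h1 := (ContinuousMap.dist_apply_le_dist (f := f₀) (g := u) ⟨x, hx⟩).trans hu.le
    rw [dist_comm, dist_eq_norm, hp ⟨x, hx⟩] at h1
    simpa [f₀] using h1
  · have h1 := (ContinuousMap.dist_apply_le_dist (f := 1) (g := u * v) ⟨x, hx⟩).trans huv.le
    rw [dist_eq_norm, ContinuousMap.mul_apply, hp ⟨x, hx⟩, hq ⟨x, hx⟩] at h1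
    simpa using h1

/-- The `i`-th coordinate function on a subset of `ℂ^N`. -/
def coordFun {N : ℕ} (K : Set (Fin N → ℂ)) (i : Fin N) : C(↥K, ℂ) :=
  ⟨fun x => (x : Fin N → ℂ) i, (continuous_apply i).comp continuous_subtype_val⟩

/-- The algebra of polynomial functions on a subset of `ℂ^N`. -/
noncomputable def polyFun {N : ℕ} (K : Set (Fin N → ℂ)) : Subalgebra ℂ C(↥K, ℂ) :=
  (MvPolynomial.aeval (coordFun K)).range

theorem aeval_coord_apply {N : ℕ} (K : Set (Fin N → ℂ)) (p : MvPolynomial (Fin N) ℂ) (x : K) :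
    MvPolynomial.aeval (coordFun K) p x =
      MvPolynomial.eval (x : Fin N → ℂ) p := by
  induction p using MvPolynomial.induction_on with
  | C a => simp
  | add p q hp hq => simp [hp, hq]
  | mul_X p i hp => simp [hp, coordFun]

theorem dense_isUnit_topologicalClosure_polyFun {N : ℕ} {X K : Set (Fin N → ℂ)} (hX : IsCompact X)
    (hd : polyAlg X ⊆ closure {g : C(↥X, ℂ) | g ∈ polyAlg X ∧ ∃ h ∈ polyAlg X, g * h = 1})
    (hK : K ⊆ polyHull X) [CompactSpace K] :
    Dense {a : (polyFun K).topologicalClosure | IsUnit a} := by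
  have : CompleteSpace (polyFun K).topologicalClosure :=
    (polyFun K).isClosed_topologicalClosure.completeSpace_coe
  intro a
  rw [Metric.mem_closure_iff]
  intro ε hε
  let ev : MvPolynomial (Fin N) ℂ →ₐ[ℂ] C(↥K, ℂ) := MvPolynomial.aeval (coordFun K)
  have hev : ∀ p, ev p ∈ (polyFun K).topologicalClosure := fun p =>
    (polyFun K).le_topologicalClosure ⟨p, rfl⟩
  have hnorm : ∀ (p : MvPolynomial (Fin N) ℂ) (c : ℝ), 0 ≤ c →
      (∀ x ∈ X, ‖MvPolynomial.eval x p‖ ≤ c) → ‖ev p‖ ≤ c := by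
    intro p c hc h
    rw [ContinuousMap.norm_le _ hc]
    intro x
    rw [aeval_coord_apply]
    exact norm_eval_le_of_mem_polyHull (hK x.2) hc h
  obtain ⟨_, ⟨p₀, rfl⟩, hp₀⟩ := Metric.mem_closure_iff.1 (show (a : C(↥K, ℂ)) ∈
    closure (polyFun K : Set C(↥K, ℂ)) from a.2) (ε / 2) (half_pos hε)
  obtain ⟨p, q, hp, hpq⟩ := exists_approx_inverse hX hd p₀ (half_pos (half_pos hε))
  refine ⟨⟨ev p, hev p⟩, ?_, ?_⟩
  · have h1 : ‖(1 : (polyFun K).topologicalClosure) - ⟨ev p, hev p⟩ * ⟨ev q, hev q⟩‖ < 1 := by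
      have h2 := hnorm (1 - p * q) (1 / 2) (by norm_num) hpq
      rw [map_sub, map_one, map_mul] at h2
      exact h2.trans_lt (by norm_num)
    have h2 := isUnit_one_sub_of_norm_lt_one h1
    rw [sub_sub_cancel] at h2
    exact isUnit_of_mul_isUnit_left h2
  · have h1 := hnorm (p - p₀) (ε / 2 / 2) (by positivity) hp
    rw [map_sub, ← dist_eq_norm, dist_comm] at h1
    have h2 := dist_triangle (a : C(↥K, ℂ)) (ev p₀) (ev p)
    have h3 : dist (a : C(↥K, ℂ)) (ev p₀) < ε / 2 := hp₀
    change dist (a : C(↥K, ℂ)) (ev p) < ε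
    linarith

end DenseInvertibles

/-- If `P(X)` has dense invertibles, then every compact, locally connected subset of the
polynomial hull `X̂` with vanishing first Čech cohomology has covering dimension ≤ 1. -/
theorem stmt_16 {N : ℕ} (X : Set (Fin N → ℂ)) (hX : IsCompact X)
    (hd : polyAlg X ⊆ closure {g : C(↥X, ℂ) | g ∈ polyAlg X ∧ ∃ h ∈ polyAlg X, g * h = 1})
    (K : Set (Fin N → ℂ)) (hK : K ⊆ polyHull X) (hKc : IsCompact K)
    (hlc : LocallyConnectedSpace ↥K) (hH1 : FirstCechH1Trivial ↥K) :
    CoveringDimLE ↥K 1 := by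
  have : CompactSpace K := isCompact_iff_compactSpace.1 hKc
  have : CompleteSpace (polyFun K).topologicalClosure :=
    (polyFun K).isClosed_topologicalClosure.completeSpace_coe
  refine coveringDimLE_one_of_dense_isUnit hH1 (polyFun K).topologicalClosure
    (dense_isUnit_topologicalClosure_polyFun hX hd hK) fun x y hxy => ?_
  obtain ⟨i, hi⟩ := Function.ne_iff.1 fun h => hxy (Subtype.ext h)
  refine ⟨_, (polyFun K).le_topologicalClosure ⟨MvPolynomial.X i, rfl⟩, ?_⟩
  simpa [coordFun] using hi
end
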